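/- arXiv:1510.00325 — 3 statements merged into one kernel-verified Lean document; each statement's English description precedes it below -/
import Mathlib

section
/- Let s > 1/2 and let V ⊆ ℝ^d be a linear subspace of dimension k, 0 ≤ k ≤ d. Let u ∈ 𝒮'(ℝ^d) be the tempered distribution given by integration over V with respect to the k-dimensional Lebesgue (Hausdorff) measure σ_V on V, i.e. u(φ) = ∫_V φ dσ_V. Then WF^s(u) = (V × V^⊥) \ {0}, where V^⊥ is the orthogonal complement of V; that is, (x₀,ξ₀) ∈ ℝ^{2d} \ {0} belongs to WF^s(u) if and only if x₀ ∈ V and ξ₀ ∈ V^⊥. -/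
open MeasureTheory Filter
open scoped BigOperators ENNReal RealInnerProductSpace

noncomputable section

/-- `ℝ^d` with the Euclidean norm. -/
abbrev Ed (d : ℕ) : Type := EuclideanSpace ℝ (Fin d)

/-- Partial derivative along the `i`-th coordinate direction. -/
def pdGS {d : ℕ} (i : Fin d) (f : Ed d → ℂ) : Ed d → ℂ :=
  fun x => fderiv ℝ f x (EuclideanSpace.single i 1)

/-- Multi-index partial derivative `∂^β`. -/
def mderiv {d : ℕ} (β : Fin d → ℕ) (f : Ed d → ℂ) : Ed d → ℂ :=
  ((List.ofFn fun i : Fin d => (pdGS i)^[β i]).foldr (· ∘ ·) id) f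

/-- Monomial `x^α`. -/
def mpow {d : ℕ} (x : Ed d) (α : Fin d → ℕ) : ℝ := ∏ i, x i ^ α i

/-- Multi-index factorial `α!`. -/
def mfact {d : ℕ} (α : Fin d → ℕ) : ℕ := ∏ i, Nat.factorial (α i)

/-- Multi-index length `|α|`. -/
def mlen {d : ℕ} (α : Fin d → ℕ) : ℕ := ∑ i, α i

/-- The Gelfand–Shilov seminorm `‖f‖_{S_{s,h}}`, valued in `[0,∞]`. -/
def GSnorm {d : ℕ} (s h : ℝ) (f : Ed d → ℂ) : ℝ≥0∞ :=
  ⨆ (x : Ed d) (α : Fin d → ℕ) (β : Fin d → ℕ),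
    ENNReal.ofReal (|mpow x α| * ‖mderiv β f x‖ /
      (h ^ (mlen α + mlen β) * ((mfact α : ℝ) * (mfact β : ℝ)) ^ s))

/-- The Gelfand–Shilov space `Σ_s(ℝ^d)`: smooth functions all of whose
`S_{s,h}` seminorms are finite. -/
def SigmaGS (s : ℝ) (d : ℕ) : Set (Ed d → ℂ) :=
  {f | ContDiff ℝ ((⊤ : ℕ∞) : WithTop ℕ∞) f ∧ ∀ h : ℝ, 0 < h → GSnorm s h f < ⊤}

/-- The seminorm `|f|_A`, valued in `[0,∞]`. -/
def GSnormA {d : ℕ} (s A : ℝ) (f : Ed d → ℂ) : ℝ≥0∞ :=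
  ⨆ (x : Ed d) (β : Fin d → ℕ),
    ENNReal.ofReal (A ^ mlen β * Real.exp (A * ‖x‖ ^ (1/s)) * ‖mderiv β f x‖ /
      (mfact β : ℝ) ^ s)

/-- The Fourier transform `f̂(ξ) = ∫ f(x) e^{-i⟨x,ξ⟩} dx`. -/
def FTgs {d : ℕ} (f : Ed d → ℂ) (ξ : Ed d) : ℂ :=
  ∫ x : Ed d, f x * Complex.exp (-(Complex.I * (⟪x, ξ⟫ : ℝ)))

/-- The short-time Fourier transform of a function `f` with window `φ`. -/
def STFTgs {d : ℕ} (φ f : Ed d → ℂ) (z : Ed d × Ed d) : ℂ :=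
  ∫ y : Ed d, f y * (starRingEnd ℂ) (φ (y - z.1)) * Complex.exp (-(Complex.I * (⟪y, z.2⟫ : ℝ)))

/-- Euclidean norm of a phase-space point `(x,ξ) ∈ ℝ^{2d}`. -/
def pnorm {d : ℕ} (z : Ed d × Ed d) : ℝ := Real.sqrt (‖z.1‖ ^ 2 + ‖z.2‖ ^ 2)

/-- A conic subset: invariant under multiplication by positive reals. -/
def IsConic {V : Type*} [SMul ℝ V] (Γ : Set V) : Prop :=
  ∀ t : ℝ, 0 < t → ∀ z ∈ Γ, t • z ∈ Γ

/-- Tempered distributions on `ℝ^d`. -/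
abbrev TD (d : ℕ) : Type := SchwartzMap (Ed d) ℂ →L[ℂ] ℂ

/-- `W` is the short-time Fourier transform `V_φ u` of the tempered distribution `u`
with respect to the window `φ`. -/
def IsSTFT {d : ℕ} (u : TD d) (φ : Ed d → ℂ) (W : Ed d × Ed d → ℂ) : Prop :=
  ∀ (x ξ : Ed d) (g : SchwartzMap (Ed d) ℂ),
    (∀ y : Ed d, g y = (starRingEnd ℂ) (φ (y - x)) * Complex.exp (-(Complex.I * (⟪y, ξ⟫ : ℝ)))) →
    W (x, ξ) = u g

/-- The `s`-Gelfand–Shilov wave front set of a distribution whose short-time Fourier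
transform is `W`: the set of nonzero phase-space points having no open conic
neighbourhood on which `e^{A|z|^{1/s}} |W(z)|` is bounded for every `A > 0`. -/
def WFs {d : ℕ} (s : ℝ) (W : Ed d × Ed d → ℂ) : Set (Ed d × Ed d) :=
  {z₀ | z₀ ≠ 0 ∧ ¬ ∃ Γ : Set (Ed d × Ed d), IsOpen Γ ∧ IsConic Γ ∧
    (0 : Ed d × Ed d) ∉ Γ ∧ z₀ ∈ Γ ∧
    ∀ A : ℝ, 0 < A → ∃ C : ℝ, ∀ z ∈ Γ, Real.exp (A * pnorm z ^ (1/s)) * ‖W z‖ ≤ C}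

/-- The real quadratic form `⟨Bx, x⟩` of a matrix `B`. -/
def qf {d : ℕ} (B : Matrix (Fin d) (Fin d) ℝ) (x : Ed d) : ℝ :=
  ∑ i, (∑ j, B i j * x j) * x i

/-- Tempered distributions on `ℝ^m × ℝ^n`. -/
abbrev TD2 (m n : ℕ) : Type := SchwartzMap (Ed m × Ed n) ℂ →L[ℂ] ℂ

/-- Short-time Fourier transform of a tempered distribution on `ℝ^m × ℝ^n`. -/
def IsSTFT2 {m n : ℕ} (w : TD2 m n) (Φ : Ed m × Ed n → ℂ)
    (W : (Ed m × Ed n) × (Ed m × Ed n) → ℂ) : Prop :=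
  ∀ (x ξ : Ed m × Ed n) (g : SchwartzMap (Ed m × Ed n) ℂ),
    (∀ y : Ed m × Ed n, g y = (starRingEnd ℂ) (Φ (y - x)) *
      Complex.exp (-(Complex.I * ((⟪y.1, ξ.1⟫ + ⟪y.2, ξ.2⟫ : ℝ))))) →
    W (x, ξ) = w g

/-- Euclidean norm of a phase-space point of `T^*(ℝ^m × ℝ^n)`. -/
def pnorm2 {m n : ℕ} (z : (Ed m × Ed n) × (Ed m × Ed n)) : ℝ :=
  Real.sqrt (‖z.1.1‖ ^ 2 + ‖z.1.2‖ ^ 2 + ‖z.2.1‖ ^ 2 + ‖z.2.2‖ ^ 2)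

/-- The `s`-Gelfand–Shilov wave front set on `ℝ^m × ℝ^n`. -/
def WFs2 {m n : ℕ} (s : ℝ) (W : (Ed m × Ed n) × (Ed m × Ed n) → ℂ) :
    Set ((Ed m × Ed n) × (Ed m × Ed n)) :=
  {z₀ | z₀ ≠ 0 ∧ ¬ ∃ Γ : Set ((Ed m × Ed n) × (Ed m × Ed n)), IsOpen Γ ∧ IsConic Γ ∧
    (0 : (Ed m × Ed n) × (Ed m × Ed n)) ∉ Γ ∧ z₀ ∈ Γ ∧
    ∀ A : ℝ, 0 < A → ∃ C : ℝ, ∀ z ∈ Γ, Real.exp (A * pnorm2 z ^ (1/s)) * ‖W z‖ ≤ C}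

section PartialDerivatives

variable {d : ℕ}

lemma ContDiff.pdGS {f : Ed d → ℂ} (hf : ContDiff ℝ ((⊤ : ℕ∞) : WithTop ℕ∞) f) (i : Fin d) :
    ContDiff ℝ ((⊤ : ℕ∞) : WithTop ℕ∞) (pdGS i f) := by
  unfold _root_.pdGS
  exact (hf.fderiv_right (by simp)).clm_apply contDiff_const

lemma ContDiff.pdGS_iterate {f : Ed d → ℂ} (hf : ContDiff ℝ ((⊤ : ℕ∞) : WithTop ℕ∞) f)
    (i : Fin d) (n : ℕ) : ContDiff ℝ ((⊤ : ℕ∞) : WithTop ℕ∞) ((_root_.pdGS i)^[n] f) := by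
  induction n with
  | zero => exact hf
  | succ n ih => rw [Function.iterate_succ_apply']; exact ih.pdGS i

lemma pdGS_comm {f : Ed d → ℂ} (hf : ContDiff ℝ ((⊤ : ℕ∞) : WithTop ℕ∞) f) (i j : Fin d) :
    pdGS i (pdGS j f) = pdGS j (pdGS i f) := by
  funext x
  have hf2 : ContDiff ℝ 2 f := contDiff_infty.1 hf 2
  have hd : DifferentiableAt ℝ (fderiv ℝ f) x :=
    ((hf2.fderiv_right (m := 1) (by norm_num)).differentiable one_ne_zero) x
  have key : ∀ a b : Fin d, pdGS a (pdGS b f) x =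
      fderiv ℝ (fderiv ℝ f) x (EuclideanSpace.single a 1) (EuclideanSpace.single b 1) := by
    intro a b
    unfold pdGS
    rw [fderiv_clm_apply hd (differentiableAt_const _)]
    simp
  rw [key, key]
  have hs : IsSymmSndFDerivAt ℝ f x :=
    hf2.contDiffAt.isSymmSndFDerivAt (by simp)
  exact hs.eq _ _

lemma pdGS_iterate_comm {f : Ed d → ℂ} (hf : ContDiff ℝ ((⊤ : ℕ∞) : WithTop ℕ∞) f)
    (i j : Fin d) (n : ℕ) : pdGS i ((pdGS j)^[n] f) = (pdGS j)^[n] (pdGS i f) := by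
  induction n with
  | zero => rfl
  | succ n ih =>
    rw [Function.iterate_succ_apply', Function.iterate_succ_apply',
      pdGS_comm (hf.pdGS_iterate j n), ih]

/-- The composition of the iterated partial derivatives `∂_i^{β_i}` along a list of indices. -/
def pdGSList (l : List (Fin d)) (β : Fin d → ℕ) (f : Ed d → ℂ) : Ed d → ℂ :=
  ((l.map fun i => (pdGS i)^[β i]).foldr (· ∘ ·) id) f

lemma mderiv_eq_pdGSList (β : Fin d → ℕ) (f : Ed d → ℂ) :
    mderiv β f = pdGSList (List.finRange d) β f := by
  rw [mderiv, pdGSList, List.ofFn_eq_map]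

lemma pdGSList_cons (i : Fin d) (l : List (Fin d)) (β : Fin d → ℕ) (f : Ed d → ℂ) :
    pdGSList (i :: l) β f = (pdGS i)^[β i] (pdGSList l β f) := rfl

lemma contDiff_pdGSList {f : Ed d → ℂ} (hf : ContDiff ℝ ((⊤ : ℕ∞) : WithTop ℕ∞) f)
    (l : List (Fin d)) (β : Fin d → ℕ) :
    ContDiff ℝ ((⊤ : ℕ∞) : WithTop ℕ∞) (pdGSList l β f) := by
  induction l with
  | nil => exact hf
  | cons i l ih => rw [pdGSList_cons]; exact ih.pdGS_iterate i _

lemma pdGSList_add_single_of_notMem {l : List (Fin d)} {i : Fin d} (hi : i ∉ l)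
    (β : Fin d → ℕ) (f : Ed d → ℂ) : pdGSList l (β + Pi.single i 1) f = pdGSList l β f := by
  induction l with
  | nil => rfl
  | cons j l ih =>
    have hji : j ≠ i := fun h => hi (by simp [h])
    rw [pdGSList_cons, pdGSList_cons, ih (fun h => hi (List.mem_cons_of_mem _ h))]
    simp [hji]

lemma pdGS_pdGSList {f : Ed d → ℂ} (hf : ContDiff ℝ ((⊤ : ℕ∞) : WithTop ℕ∞) f)
    {l : List (Fin d)} (hl : l.Nodup) {i : Fin d} (hi : i ∈ l) (β : Fin d → ℕ) :
    pdGS i (pdGSList l β f) = pdGSList l (β + Pi.single i 1) f := by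
  induction l with
  | nil => simp at hi
  | cons j l ih =>
    rw [List.nodup_cons] at hl
    rw [pdGSList_cons, pdGSList_cons]
    by_cases hji : j = i
    · subst hji
      rw [pdGSList_add_single_of_notMem hl.1, ← Function.iterate_succ_apply' (pdGS j)]
      simp
    · have hil : i ∈ l := by
        rcases List.mem_cons.1 hi with h | h
        · exact absurd h.symm hji
        · exact h
      rw [pdGS_iterate_comm (contDiff_pdGSList hf l β), ih hl.2 hil]
      simp [hji]

lemma pdGS_mderiv {f : Ed d → ℂ} (hf : ContDiff ℝ ((⊤ : ℕ∞) : WithTop ℕ∞) f) (i : Fin d)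
    (β : Fin d → ℕ) : pdGS i (mderiv β f) = mderiv (β + Pi.single i 1) f := by
  rw [mderiv_eq_pdGSList, mderiv_eq_pdGSList,
    pdGS_pdGSList hf (List.nodup_finRange d) (List.mem_finRange i)]

lemma mderiv_zero (f : Ed d → ℂ) : mderiv 0 f = f := by
  rw [mderiv_eq_pdGSList]
  induction List.finRange d with
  | nil => rfl
  | cons i l ih => rw [pdGSList_cons, ih]; rfl

lemma exists_foldr_pdGS_eq_mderiv {f : Ed d → ℂ}
    (hf : ContDiff ℝ ((⊤ : ℕ∞) : WithTop ℕ∞) f) (L : List (Fin d)) :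
    ∃ β : Fin d → ℕ, mlen β = L.length ∧ L.foldr pdGS f = mderiv β f := by
  induction L with
  | nil => exact ⟨0, by simp [mlen], (mderiv_zero f).symm⟩
  | cons i L ih =>
    obtain ⟨β, h1, h2⟩ := ih
    refine ⟨β + Pi.single i 1, ?_, ?_⟩
    · simp only [mlen, Pi.add_apply, Finset.sum_add_distrib, List.length_cons] at h1 ⊢
      rw [h1]; simp
    · rw [List.foldr_cons, h2, pdGS_mderiv hf]

lemma fderiv_eq_sum_pdGS (f : Ed d → ℂ) (x : Ed d) :
    fderiv ℝ f x = ∑ i : Fin d, ContinuousLinearMap.smulRightL ℝ (Ed d) ℂ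
      (EuclideanSpace.proj i : Ed d →L[ℝ] ℝ) (pdGS i f x) := by
  ext v
  have hv : v = ∑ i : Fin d, v i • EuclideanSpace.single i (1 : ℝ) := by
    have := (EuclideanSpace.basisFun (Fin d) ℝ).sum_repr v
    simpa using this.symm
  conv_lhs => rw [hv]
  simp [pdGS]

lemma norm_smulRightL_proj_le (i : Fin d) :
    ‖ContinuousLinearMap.smulRightL ℝ (Ed d) ℂ (EuclideanSpace.proj i : Ed d →L[ℝ] ℝ)‖ ≤ 1 := by
  refine ContinuousLinearMap.opNorm_le_bound _ zero_le_one fun z => ?_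
  have h1 : ‖(EuclideanSpace.proj i : Ed d →L[ℝ] ℝ)‖ ≤ 1 :=
    ContinuousLinearMap.opNorm_le_bound _ zero_le_one fun v => by
      simpa using PiLp.norm_apply_le v i
  change ‖(EuclideanSpace.proj i : Ed d →L[ℝ] ℝ).smulRight z‖ ≤ _
  rw [ContinuousLinearMap.norm_smulRight_apply]
  gcongr

lemma norm_iteratedFDeriv_succ_le_sum_pdGS {f : Ed d → ℂ}
    (hf : ContDiff ℝ ((⊤ : ℕ∞) : WithTop ℕ∞) f) (n : ℕ) (x : Ed d) :
    ‖iteratedFDeriv ℝ (n + 1) f x‖ ≤ ∑ i : Fin d, ‖iteratedFDeriv ℝ n (pdGS i f) x‖ := by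
  rw [← norm_iteratedFDeriv_fderiv, funext (fderiv_eq_sum_pdGS f)]
  have hn : ((n : ℕ∞) : WithTop ℕ∞) ≤ ((⊤ : ℕ∞) : WithTop ℕ∞) := by exact_mod_cast le_top
  rw [iteratedFDeriv_fun_sum_apply (𝕜 := ℝ) (fun i _ => by
    exact ((ContinuousLinearMap.contDiff _).comp ((hf.pdGS i).of_le hn)).contDiffAt)]
  refine (norm_sum_le _ _).trans (Finset.sum_le_sum fun i _ => ?_)
  refine (ContinuousLinearMap.norm_iteratedFDeriv_comp_left _
    (hf.pdGS i).contDiffAt hn).trans ?_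
  exact mul_le_of_le_one_left (norm_nonneg _) (norm_smulRightL_proj_le i)

lemma norm_iteratedFDeriv_le_of_foldr_pdGS {f : Ed d → ℂ}
    (hf : ContDiff ℝ ((⊤ : ℕ∞) : WithTop ℕ∞) f) (n : ℕ) (x : Ed d) (B : ℝ)
    (h : ∀ L : List (Fin d), L.length = n → ‖L.foldr pdGS f x‖ ≤ B) :
    ‖iteratedFDeriv ℝ n f x‖ ≤ (d : ℝ) ^ n * B := by
  induction n generalizing f with
  | zero => simpa using h [] rfl
  | succ n ih =>
    refine (norm_iteratedFDeriv_succ_le_sum_pdGS hf n x).trans ?_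
    have : ∀ i ∈ (Finset.univ : Finset (Fin d)),
        ‖iteratedFDeriv ℝ n (pdGS i f) x‖ ≤ (d : ℝ) ^ n * B := by
      intro i _
      refine ih (hf.pdGS i) fun L hL => ?_
      have := h (L ++ [i]) (by simp [hL])
      simpa using this
    refine (Finset.sum_le_sum this).trans (le_of_eq ?_)
    simp; ring

lemma norm_iteratedFDeriv_le_of_mderiv {f : Ed d → ℂ}
    (hf : ContDiff ℝ ((⊤ : ℕ∞) : WithTop ℕ∞) f) (n : ℕ) (x : Ed d) (B : ℝ)
    (h : ∀ β : Fin d → ℕ, mlen β = n → ‖mderiv β f x‖ ≤ B) :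
    ‖iteratedFDeriv ℝ n f x‖ ≤ (d : ℝ) ^ n * B := by
  refine norm_iteratedFDeriv_le_of_foldr_pdGS hf n x B fun L hL => ?_
  obtain ⟨β, h1, h2⟩ := exists_foldr_pdGS_eq_mderiv hf L
  rw [h2]
  exact h β (h1.trans hL)

lemma norm_pow_mul_le_of_mpow (x : Ed d) (m : ℕ) {F B : ℝ} (hF : 0 ≤ F)
    (h : ∀ α : Fin d → ℕ, mlen α = m → |mpow x α| * F ≤ B) :
    ‖x‖ ^ m * F ≤ (d : ℝ) ^ m * B := by
  rcases Nat.eq_zero_or_pos d with hd | hd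
  · subst hd
    have hx : ‖x‖ = 0 := by rw [Subsingleton.elim x 0, norm_zero]
    rcases Nat.eq_zero_or_pos m with hm | hm
    · subst hm
      simpa [mpow] using h 0 (by simp [mlen])
    · simp [hx, hm.ne']
  · have : Nonempty (Fin d) := ⟨⟨0, hd⟩⟩
    obtain ⟨i, hi⟩ := Finite.exists_max fun j => |x j|
    have hx : ‖x‖ ≤ d * |x i| := by
      have h1 : ‖x‖ ≤ ∑ j, |x j| := by
        have hv : x = ∑ j : Fin d, x j • EuclideanSpace.single j (1 : ℝ) := by
          have := (EuclideanSpace.basisFun (Fin d) ℝ).sum_repr x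
          simpa using this.symm
        conv_lhs => rw [hv]
        refine (norm_sum_le _ _).trans (le_of_eq ?_)
        simp [norm_smul]
      refine h1.trans ((Finset.sum_le_sum fun j _ => hi j).trans (le_of_eq ?_))
      simp
    have h2 := h (Pi.single i m) (by simp [mlen])
    have h3 : |mpow x (Pi.single i m)| = |x i| ^ m := by
      rw [mpow, Finset.prod_eq_single i]
      · simp [abs_pow]
      · intro j _ hj
        simp [hj]
      · simp
    rw [h3] at h2
    calc ‖x‖ ^ m * F ≤ (d * |x i|) ^ m * F := by gcongr
      _ = d ^ m * (|x i| ^ m * F) := by ring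
      _ ≤ d ^ m * B := by gcongr

end PartialDerivatives

section GelfandShilovBounds

variable {d : ℕ}

/-- Factorial power bounds for all scales give exponential decay of order `1 / s`. -/
lemma exists_exp_mul_le_of_pow_mul_le {ι : Type*} {s : ℝ} (hs : 0 < s) (t a : ι → ℝ)
    (ht : ∀ i, 0 ≤ t i) (ha : ∀ i, 0 ≤ a i)
    (H : ∀ h : ℝ, 0 < h → ∃ C : ℝ, ∀ i, ∀ n : ℕ,
      t i ^ n * a i ≤ C * h ^ n * (n.factorial : ℝ) ^ s) (A : ℝ) (hA : 0 < A) :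
    ∃ C : ℝ, ∀ i, Real.exp (A * t i ^ (1 / s)) * a i ≤ C := by
  set η : ℝ := s / (2 * A) with hη
  have hη0 : 0 < η := by positivity
  obtain ⟨C₀, hC₀⟩ := H (η ^ s) (by positivity)
  set C : ℝ := max C₀ 0
  have hC : ∀ i, ∀ n : ℕ, t i ^ n * a i ≤ C * (η ^ s) ^ n * (n.factorial : ℝ) ^ s := by
    intro i n
    refine (hC₀ i n).trans ?_
    gcongr
    exact le_max_left _ _
  have hC0 : 0 ≤ C := le_max_right _ _
  refine ⟨(2 * C ^ (1 / s)) ^ s, fun i => ?_⟩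
  set T := t i ^ (1 / s) with hT
  have hT0 : 0 ≤ T := Real.rpow_nonneg (ht i) _
  have hs1 : 1 / s * s = 1 := by field_simp
  have hTs : T ^ s = t i := by rw [hT, ← Real.rpow_mul (ht i), hs1, Real.rpow_one]
  set b := a i ^ (1 / s) with hb
  have hb0 : 0 ≤ b := Real.rpow_nonneg (ha i) _
  have hbs : b ^ s = a i := by rw [hb, ← Real.rpow_mul (ha i), hs1, Real.rpow_one]
  set D := C ^ (1 / s) with hD
  have hD0 : 0 ≤ D := Real.rpow_nonneg hC0 _
  have hDs : D ^ s = C := by rw [hD, ← Real.rpow_mul hC0, hs1, Real.rpow_one]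
  have step : ∀ n : ℕ, T ^ n * b ≤ D * η ^ n * n.factorial := by
    intro n
    have h1 := hC i n
    rw [← Real.rpow_le_rpow_iff (z := s) (by positivity) (by positivity) hs,
      Real.mul_rpow (by positivity) hb0, Real.mul_rpow (by positivity) (by positivity),
      Real.mul_rpow hD0 (by positivity), hbs, hDs, ← Real.rpow_natCast T n,
      ← Real.rpow_natCast η n, ← Real.rpow_mul hT0, ← Real.rpow_mul hη0.le, mul_comm (n : ℝ) s,
      Real.rpow_mul hT0, Real.rpow_mul hη0.le, hTs, Real.rpow_natCast, Real.rpow_natCast]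
    exact h1
  have hsum : HasSum (fun n : ℕ => (A / s * T) ^ n / (n.factorial : ℝ) * b)
      (Real.exp (A / s * T) * b) := by
    rw [Real.exp_eq_exp_ℝ]
    exact (NormedSpace.expSeries_div_hasSum_exp (A / s * T)).mul_right b
  have hgeo : HasSum (fun n : ℕ => D * (1 / 2 : ℝ) ^ n) (D * 2) := hasSum_geometric_two.mul_left D
  have hle : Real.exp (A / s * T) * b ≤ D * 2 := by
    refine hasSum_le (fun n => ?_) hsum hgeo
    have hf : (0 : ℝ) < n.factorial := by positivity
    have hη2 : A / s * η = 1 / 2 := by rw [hη]; field_simp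
    calc (A / s * T) ^ n / (n.factorial : ℝ) * b
        = (A / s) ^ n / (n.factorial : ℝ) * (T ^ n * b) := by rw [mul_pow]; ring
      _ ≤ (A / s) ^ n / (n.factorial : ℝ) * (D * η ^ n * n.factorial) := by
          exact mul_le_mul_of_nonneg_left (step n) (by positivity)
      _ = D * (A / s * η) ^ n := by rw [mul_pow]; field_simp
      _ = D * (1 / 2 : ℝ) ^ n := by rw [hη2]
  have := Real.rpow_le_rpow (by positivity) hle hs.le
  rw [Real.mul_rpow (Real.exp_pos _).le hb0, hbs, ← Real.exp_mul] at this
  rw [mul_comm 2 D]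
  convert this using 3
  field_simp

lemma exists_pow_mul_norm_iteratedFDeriv_le {s : ℝ} (hs : 0 < s) {φ : Ed d → ℂ}
    (hφ : φ ∈ SigmaGS s d) {h : ℝ} (hh : 0 < h) :
    ∃ C : ℝ, 0 ≤ C ∧ ∀ (m n : ℕ) (x : Ed d), ‖x‖ ^ m * ‖iteratedFDeriv ℝ n φ x‖ ≤
      C * h ^ (m + n) * ((m.factorial : ℝ) * n.factorial) ^ s := by
  set k : ℝ := h / (d + 1) with hk
  have hd : (0 : ℝ) < d + 1 := by positivity
  have hk0 : 0 < k := by positivity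
  have hfin := hφ.2 k hk0
  refine ⟨(GSnorm s k φ).toReal, ENNReal.toReal_nonneg, fun m n x => ?_⟩
  set C := (GSnorm s k φ).toReal
  have hC0 : 0 ≤ C := ENNReal.toReal_nonneg
  have key : ∀ α β : Fin d → ℕ, |mpow x α| * ‖mderiv β φ x‖ ≤
      C * k ^ (mlen α + mlen β) * (((mlen α).factorial : ℝ) * (mlen β).factorial) ^ s := by
    intro α β
    have h1 : ENNReal.ofReal (|mpow x α| * ‖mderiv β φ x‖ /
        (k ^ (mlen α + mlen β) * ((mfact α : ℝ) * (mfact β : ℝ)) ^ s)) ≤ GSnorm s k φ :=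
      le_iSup_of_le x (le_iSup_of_le α (le_iSup_of_le β le_rfl))
    have h2 := (ENNReal.ofReal_le_iff_le_toReal hfin.ne).1 h1
    have hpos : ∀ γ : Fin d → ℕ, 0 < mfact γ := fun γ =>
      Finset.prod_pos fun i _ => Nat.factorial_pos _
    have hle : ∀ γ : Fin d → ℕ, mfact γ ≤ (mlen γ).factorial := fun γ =>
      Nat.le_of_dvd (Nat.factorial_pos _)
        (Nat.prod_factorial_dvd_factorial_sum Finset.univ γ)
    have hα : (0 : ℝ) < mfact α := by exact_mod_cast hpos α
    have hβ : (0 : ℝ) < mfact β := by exact_mod_cast hpos β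
    rw [div_le_iff₀ (by positivity)] at h2
    refine h2.trans ?_
    rw [mul_assoc]
    gcongr
    · exact hle α
    · exact hle β
  have h1 : ∀ α : Fin d → ℕ, mlen α = m → |mpow x α| * ‖iteratedFDeriv ℝ n φ x‖ ≤
      (d : ℝ) ^ n * (C * k ^ (m + n) * ((m.factorial : ℝ) * n.factorial) ^ s) := by
    intro α hα
    rcases (abs_nonneg (mpow x α)).eq_or_lt with h0 | h0
    · rw [← h0, zero_mul]; positivity
    · have := norm_iteratedFDeriv_le_of_mderiv hφ.1 n x
        ((C * k ^ (m + n) * ((m.factorial : ℝ) * n.factorial) ^ s) / |mpow x α|) fun β hβ => by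
          rw [le_div_iff₀ h0, mul_comm]
          have := key α β
          rwa [hα, hβ] at this
      rw [mul_div_assoc', le_div_iff₀ h0] at this
      rwa [mul_comm]
  refine (norm_pow_mul_le_of_mpow x m (norm_nonneg _) h1).trans ?_
  have h2 : (d : ℝ) ^ m * (d : ℝ) ^ n * k ^ (m + n) ≤ h ^ (m + n) := by
    rw [← pow_add, ← mul_pow]
    refine pow_le_pow_left₀ (by positivity) ?_ _
    rw [hk, mul_div_assoc', div_le_iff₀ hd]
    nlinarith
  calc (d : ℝ) ^ m * ((d : ℝ) ^ n * (C * k ^ (m + n) * ((m.factorial : ℝ) * n.factorial) ^ s))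
      = C * ((d : ℝ) ^ m * (d : ℝ) ^ n * k ^ (m + n)) *
          ((m.factorial : ℝ) * n.factorial) ^ s := by ring
    _ ≤ _ := by gcongr

lemma Nat.factorial_add_le_two_pow (m N : ℕ) :
    (m + N).factorial ≤ 2 ^ (m + N) * (m.factorial * N.factorial) := by
  rw [← Nat.add_choose_mul_factorial_mul_factorial m N, mul_assoc]
  gcongr
  exact Nat.choose_le_two_pow _ _

lemma exists_one_add_norm_pow_mul_iteratedFDeriv_le {s : ℝ} (hs : 0 < s) {φ : Ed d → ℂ}
    (hφ : φ ∈ SigmaGS s d) (N : ℕ) {h : ℝ} (hh : 0 < h) :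
    ∃ C : ℝ, 0 ≤ C ∧ ∀ (m n : ℕ) (x : Ed d),
      (1 + ‖x‖) ^ N * (‖x‖ ^ m * ‖iteratedFDeriv ℝ n φ x‖) ≤
      C * h ^ (m + n) * ((m.factorial : ℝ) * n.factorial) ^ s := by
  set r : ℝ := 2 ^ s with hr
  have hr1 : 1 ≤ r := Real.one_le_rpow (by norm_num) hs.le
  have hr0 : 0 < r := by positivity
  obtain ⟨C, hC0, hC⟩ := exists_pow_mul_norm_iteratedFDeriv_le hs hφ (h := h / r) (by positivity)
  refine ⟨2 ^ N * (C * (1 + h ^ N * (N.factorial : ℝ) ^ s)), by positivity, fun m n x => ?_⟩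
  set a := ‖iteratedFDeriv ℝ n φ x‖
  set F := ((m.factorial : ℝ) * n.factorial) ^ s
  have h1 : (1 + ‖x‖) ^ N ≤ 2 ^ N * (1 + ‖x‖ ^ N) := by
    rcases le_total ‖x‖ 1 with hx | hx
    · calc (1 + ‖x‖) ^ N ≤ 2 ^ N := by gcongr; linarith
        _ ≤ _ := le_mul_of_one_le_right (by positivity) (by linarith [pow_nonneg (norm_nonneg x) N])
    · calc (1 + ‖x‖) ^ N ≤ (2 * ‖x‖) ^ N := by gcongr; linarith
        _ = 2 ^ N * ‖x‖ ^ N := mul_pow _ _ _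
        _ ≤ _ := by gcongr; linarith
  have hhr : h / r ≤ h := div_le_self hh.le hr1
  have h2 : ‖x‖ ^ m * a ≤ C * h ^ (m + n) * F := by
    refine (hC m n x).trans ?_
    gcongr
  have h3 : ‖x‖ ^ (m + N) * a ≤ C * (h ^ N * (N.factorial : ℝ) ^ s) * h ^ (m + n) * F := by
    refine (hC (m + N) n x).trans ?_
    have hf : (((m + N).factorial : ℝ) * n.factorial) ^ s ≤
        r ^ (m + N) * (N.factorial : ℝ) ^ s * F := by
      have : ((m + N).factorial : ℝ) ≤ 2 ^ (m + N) * (m.factorial * N.factorial) := by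
        exact_mod_cast Nat.factorial_add_le_two_pow m N
      calc (((m + N).factorial : ℝ) * n.factorial) ^ s
          ≤ (2 ^ (m + N) * N.factorial * (m.factorial * n.factorial)) ^ s := by
            refine Real.rpow_le_rpow (by positivity) ?_ hs.le
            calc ((m + N).factorial : ℝ) * n.factorial
                ≤ 2 ^ (m + N) * (m.factorial * N.factorial) * n.factorial := by gcongr
              _ = _ := by ring
        _ = _ := by
            rw [Real.mul_rpow (by positivity) (by positivity),
              Real.mul_rpow (by positivity) (by positivity), hr, ← Real.rpow_natCast 2,
              ← Real.rpow_natCast (2 ^ s), ← Real.rpow_mul (by norm_num),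
              ← Real.rpow_mul (by norm_num), mul_comm s]
    have hp : (h / r) ^ (m + N + n) * r ^ (m + N) ≤ h ^ N * h ^ (m + n) := by
      rw [div_pow, div_mul_eq_mul_div, div_le_iff₀ (by positivity)]
      calc h ^ (m + N + n) * r ^ (m + N) ≤ h ^ (m + N + n) * r ^ (m + N + n) := by
            exact mul_le_mul_of_nonneg_left (pow_le_pow_right₀ hr1 (by omega)) (by positivity)
        _ = _ := by ring
    calc C * (h / r) ^ (m + N + n) * (((m + N).factorial : ℝ) * n.factorial) ^ s
        ≤ C * (h / r) ^ (m + N + n) * (r ^ (m + N) * (N.factorial : ℝ) ^ s * F) := by gcongr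
      _ = C * ((h / r) ^ (m + N + n) * r ^ (m + N)) * (N.factorial : ℝ) ^ s * F := by ring
      _ ≤ C * (h ^ N * h ^ (m + n)) * (N.factorial : ℝ) ^ s * F := by gcongr
      _ = _ := by ring
  calc (1 + ‖x‖) ^ N * (‖x‖ ^ m * a) ≤ 2 ^ N * (1 + ‖x‖ ^ N) * (‖x‖ ^ m * a) := by gcongr
    _ = 2 ^ N * (‖x‖ ^ m * a + ‖x‖ ^ (m + N) * a) := by ring
    _ ≤ 2 ^ N * (C * h ^ (m + n) * F + C * (h ^ N * (N.factorial : ℝ) ^ s) * h ^ (m + n) * F) := by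
        gcongr
    _ = _ := by ring

/-- A Gelfand–Shilov function as a Schwartz function. -/
def SigmaGS.toSchwartz {s : ℝ} (hs : 0 < s) {φ : Ed d → ℂ} (hφ : φ ∈ SigmaGS s d) :
    SchwartzMap (Ed d) ℂ where
  toFun := φ
  smooth' := hφ.1
  decay' m n := by
    obtain ⟨C, -, hC⟩ := exists_pow_mul_norm_iteratedFDeriv_le hs hφ zero_lt_one
    exact ⟨_, hC m n⟩

lemma SigmaGS.coe_toSchwartz {s : ℝ} (hs : 0 < s) {φ : Ed d → ℂ}
    (hφ : φ ∈ SigmaGS s d) : ⇑(SigmaGS.toSchwartz hs hφ) = φ := rfl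

end GelfandShilovBounds

section FourierOnSubspace

open FourierTransform

variable {d k : ℕ}

lemma hasTemperateGrowth_cexp_neg_I_mul :
    Function.HasTemperateGrowth fun t : ℝ => Complex.exp (-(Complex.I * t)) := by
  have hsm : ContDiff ℝ ((⊤ : ℕ∞) : WithTop ℕ∞) fun t : ℝ => Complex.exp (-(Complex.I * t)) :=
    (contDiff_const.mul Complex.ofRealCLM.contDiff).neg.cexp
  have hder : ∀ n : ℕ, iteratedDeriv n (fun t : ℝ => Complex.exp (-(Complex.I * t))) =
      fun t : ℝ => (-Complex.I) ^ n * Complex.exp (-(Complex.I * t)) := by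
    intro n
    induction n with
    | zero => simp
    | succ n ih =>
      rw [iteratedDeriv_succ, ih]
      funext t
      have h1 : HasDerivAt (fun t : ℝ => -(Complex.I * (t : ℂ))) (-(Complex.I * 1)) t :=
        ((hasDerivAt_id t).ofReal_comp.const_mul Complex.I).neg
      rw [((h1.cexp).const_mul ((-Complex.I) ^ n)).deriv]
      ring
  refine ⟨hsm, fun n => ⟨0, 1, fun t => ?_⟩⟩
  rw [norm_iteratedFDeriv_eq_norm_iteratedDeriv, hder]
  have : ‖Complex.exp (-(Complex.I * t))‖ = 1 := by
    rw [show -(Complex.I * (t : ℂ)) = ((-t : ℝ) : ℂ) * Complex.I by push_cast; ring,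
      Complex.norm_exp_ofReal_mul_I]
  simp [this]

lemma hasTemperateGrowth_cexp_neg_I_mul_inner (ξ : Ed d) :
    Function.HasTemperateGrowth
      fun y : Ed d => Complex.exp (-(Complex.I * (⟪y, ξ⟫ : ℝ))) := by
  have h : Function.HasTemperateGrowth fun y : Ed d => (⟪y, ξ⟫ : ℝ) := by
    have := (innerSL ℝ ξ).hasTemperateGrowth
    convert this using 2 with y
    rw [innerSL_apply_apply, real_inner_comm]
  exact hasTemperateGrowth_cexp_neg_I_mul.comp h

/-- The conjugated, translated window restricted along a linear isometry. -/
def restrictedWindow (ι : Ed k →ₗᵢ[ℝ] Ed d) (f : SchwartzMap (Ed d) ℂ) (x : Ed d) :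
    SchwartzMap (Ed k) ℂ :=
  SchwartzMap.postcompCLM (Complex.conjCLE : ℂ →L[ℝ] ℂ)
    (SchwartzMap.compCLMOfAntilipschitz ℝ (K := 1) (g := fun y => ι y - x)
      (ι.toContinuousLinearMap.hasTemperateGrowth.sub (.const x))
      (by
        refine Isometry.antilipschitz ?_
        exact Isometry.of_dist_eq fun a b => by simp) f)

lemma restrictedWindow_apply (ι : Ed k →ₗᵢ[ℝ] Ed d) (f : SchwartzMap (Ed d) ℂ) (x : Ed d)
    (y : Ed k) : restrictedWindow ι f x y = (starRingEnd ℂ) (f (ι y - x)) := rfl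

lemma norm_iteratedFDeriv_restrictedWindow_le (ι : Ed k →ₗᵢ[ℝ] Ed d)
    (f : SchwartzMap (Ed d) ℂ) (x : Ed d) (n : ℕ) (y : Ed k) :
    ‖iteratedFDeriv ℝ n (restrictedWindow ι f x) y‖ ≤ ‖iteratedFDeriv ℝ n f (ι y - x)‖ := by
  have hg : ContDiff ℝ n fun w : Ed d => f (w - x) :=
    (f.smooth n).comp (contDiff_id.sub contDiff_const)
  have h1 : ⇑(restrictedWindow ι f x) =
      Complex.conjLIE ∘ ((fun w : Ed d => f (w - x)) ∘ ι.toContinuousLinearMap) := rfl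
  rw [h1, LinearIsometryEquiv.norm_iteratedFDeriv_comp_left,
    ContinuousLinearMap.iteratedFDeriv_comp_right _ hg _ le_rfl, iteratedFDeriv_comp_sub]
  refine (ContinuousMultilinearMap.norm_compContinuousLinearMap_le _ _).trans ?_
  refine mul_le_of_le_one_right (norm_nonneg _) ?_
  exact Finset.prod_le_one (fun _ _ => norm_nonneg _) fun _ _ => ι.norm_toContinuousLinearMap_le

/-- The adjoint of a linear isometry, as a continuous linear map. -/
def isoAdjoint (ι : Ed k →ₗᵢ[ℝ] Ed d) : Ed d →L[ℝ] Ed k :=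
  ContinuousLinearMap.adjoint ι.toContinuousLinearMap

lemma inner_isoAdjoint (ι : Ed k →ₗᵢ[ℝ] Ed d) (y : Ed k) (x : Ed d) :
    ⟪y, isoAdjoint ι x⟫ = ⟪ι y, x⟫ :=
  ContinuousLinearMap.adjoint_inner_right _ _ _

lemma isoAdjoint_apply_self (ι : Ed k →ₗᵢ[ℝ] Ed d) (y : Ed k) : isoAdjoint ι (ι y) = y := by
  refine ext_inner_left ℝ fun z => ?_
  rw [inner_isoAdjoint, ι.inner_map_map]

lemma norm_apply_sub_sq (ι : Ed k →ₗᵢ[ℝ] Ed d) (y : Ed k) (x : Ed d) :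
    ‖ι y - x‖ ^ 2 = ‖y - isoAdjoint ι x‖ ^ 2 + ‖x - ι (isoAdjoint ι x)‖ ^ 2 := by
  have h1 : ι y - x = ι (y - isoAdjoint ι x) - (x - ι (isoAdjoint ι x)) := by
    rw [map_sub]; abel
  have h2 : ⟪ι (y - isoAdjoint ι x), x - ι (isoAdjoint ι x)⟫ = 0 := by
    rw [inner_sub_right, ι.inner_map_map, inner_isoAdjoint, sub_self]
  rw [h1, norm_sub_sq_real, h2, ι.norm_map]
  ring

lemma norm_sub_isoAdjoint_le (ι : Ed k →ₗᵢ[ℝ] Ed d) (y : Ed k) (x : Ed d) :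
    ‖y - isoAdjoint ι x‖ ≤ ‖ι y - x‖ :=
  le_of_sq_le_sq (by nlinarith [norm_apply_sub_sq ι y x]) (norm_nonneg _)

lemma norm_sub_apply_isoAdjoint_le (ι : Ed k →ₗᵢ[ℝ] Ed d) (y : Ed k) (x : Ed d) :
    ‖x - ι (isoAdjoint ι x)‖ ≤ ‖ι y - x‖ :=
  le_of_sq_le_sq (by nlinarith [norm_apply_sub_sq ι y x]) (norm_nonneg _)

/-- Uniform bounds for integrals over translates of the range of a linear isometry. -/
lemma exists_norm_integral_le {s : ℝ} (hs : 0 < s) {φ : Ed d → ℂ} (hφ : φ ∈ SigmaGS s d)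
    (ι : Ed k →ₗᵢ[ℝ] Ed d) {h : ℝ} (hh : 0 < h) :
    ∃ C : ℝ, 0 ≤ C ∧ ∀ (m n : ℕ) (x : Ed d) (f : Ed k → ℝ),
      (∀ y, ‖f y‖ ≤ ‖ι y - x‖ ^ m * ‖iteratedFDeriv ℝ n φ (ι y - x)‖) →
      ‖∫ y, f y‖ ≤ C * h ^ (m + n) * ((m.factorial : ℝ) * n.factorial) ^ s := by
  obtain ⟨C, hC0, hC⟩ := exists_one_add_norm_pow_mul_iteratedFDeriv_le hs hφ (k + 1) hh
  have hintegrable : Integrable (fun y : Ed k => (1 + ‖y‖) ^ (-((k : ℝ) + 1))) :=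
    integrable_one_add_norm (by simp)
  set J : ℝ := ∫ y : Ed k, (1 + ‖y‖) ^ (-((k : ℝ) + 1)) with hJ
  have hJ0 : 0 ≤ J := integral_nonneg fun y => by positivity
  refine ⟨C * J, by positivity, fun m n x f hf => ?_⟩
  set B := C * h ^ (m + n) * ((m.factorial : ℝ) * n.factorial) ^ s
  have hB0 : 0 ≤ B := by positivity
  have hbd : ∀ y, ‖f y‖ ≤ B * (1 + ‖y - isoAdjoint ι x‖) ^ (-((k : ℝ) + 1)) := by
    intro y
    refine (hf y).trans ?_
    rw [Real.rpow_neg (by positivity), ← div_eq_mul_inv, le_div_iff₀ (by positivity)]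
    rw [show ((k : ℝ) + 1) = ((k + 1 : ℕ) : ℝ) by push_cast; ring, Real.rpow_natCast, mul_comm]
    refine le_trans ?_ (hC m n (ι y - x))
    gcongr
    exact norm_sub_isoAdjoint_le ι y x
  have hintegrable' : Integrable
      (fun y : Ed k => B * (1 + ‖y - isoAdjoint ι x‖) ^ (-((k : ℝ) + 1))) :=
    (hintegrable.comp_sub_right (isoAdjoint ι x)).const_mul B
  refine (norm_integral_le_of_norm_le hintegrable' (Eventually.of_forall hbd)).trans (le_of_eq ?_)
  rw [integral_const_mul,
    integral_sub_right_eq_self (fun y : Ed k => (1 + ‖y‖) ^ (-((k : ℝ) + 1))) (isoAdjoint ι x)]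
  ring

lemma norm_pow_mul_norm_fourier_le (f : SchwartzMap (Ed k) ℂ) (n : ℕ) (w : Ed k) :
    ‖w‖ ^ n * ‖𝓕 (f : Ed k → ℂ) w‖ ≤ ∫ y, ‖iteratedFDeriv ℝ n f y‖ := by
  have hintegrable : ∀ m : ℕ, Integrable (iteratedFDeriv ℝ m (f : Ed k → ℂ)) := by
    intro m
    have := f.integrable_pow_mul_iteratedFDeriv volume 0 m
    simp only [pow_zero, one_mul] at this
    exact (integrable_norm_iff
      ((f.smooth m).continuous_iteratedFDeriv le_rfl).aestronglyMeasurable).1 this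
  have h1 : 𝓕 (iteratedFDeriv ℝ n (f : Ed k → ℂ)) w =
      VectorFourier.fourierPowSMulRight (-innerSL ℝ) (𝓕 (f : Ed k → ℂ)) w n :=
    congrFun (Real.fourier_iteratedFDeriv (N := ⊤) (f.smooth ⊤) (fun m _ => hintegrable m)
      (n := n) le_top) w
  have h2 : ‖𝓕 (iteratedFDeriv ℝ n (f : Ed k → ℂ)) w‖ ≤ ∫ y, ‖iteratedFDeriv ℝ n f y‖ :=
    VectorFourier.norm_fourierIntegral_le_integral_norm _ _ _ _ _
  rcases (norm_nonneg w).eq_or_lt with hw | hw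
  · rw [← hw]
    rcases Nat.eq_zero_or_pos n with hn | hn
    · subst hn
      have : ‖𝓕 (f : Ed k → ℂ) w‖ ≤ ∫ y, ‖f y‖ :=
        VectorFourier.norm_fourierIntegral_le_integral_norm _ _ _ _ _
      simpa using this
    · rw [zero_pow hn.ne', zero_mul]
      exact integral_nonneg fun y => norm_nonneg _
  · have h3 := (𝓕 (iteratedFDeriv ℝ n (f : Ed k → ℂ)) w).le_opNorm fun _ => w
    nth_rewrite 1 [h1] at h3
    rw [VectorFourier.fourierPowSMulRight_apply] at h3
    simp only [neg_apply, Finset.prod_const, Finset.card_univ, Fintype.card_fin, norm_smul,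
      norm_pow, norm_neg, norm_mul, Complex.norm_I, Complex.norm_real, Real.norm_eq_abs,
      abs_of_pos Real.pi_pos, Complex.norm_ofNat] at h3
    have h6 : |innerSL ℝ w w| = ‖w‖ ^ 2 := by
      rw [innerSL_apply_apply, real_inner_self_eq_norm_sq, abs_of_nonneg (by positivity)]
    rw [h6] at h3
    have h4 : (‖w‖ ^ n * ‖𝓕 (f : Ed k → ℂ) w‖) * ‖w‖ ^ n ≤
        (∫ y, ‖iteratedFDeriv ℝ n f y‖) * ‖w‖ ^ n := by
      have h5 : (1 : ℝ) ≤ (2 * Real.pi * 1) ^ n :=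
        one_le_pow₀ (by nlinarith [Real.pi_gt_three])
      calc (‖w‖ ^ n * ‖𝓕 (f : Ed k → ℂ) w‖) * ‖w‖ ^ n
          = 1 * ((‖w‖ ^ 2) ^ n * ‖𝓕 (f : Ed k → ℂ) w‖) := by ring
        _ ≤ (2 * Real.pi * 1) ^ n * ((‖w‖ ^ 2) ^ n * ‖𝓕 (f : Ed k → ℂ) w‖) := by gcongr
        _ ≤ ‖𝓕 (iteratedFDeriv ℝ n (f : Ed k → ℂ)) w‖ * ‖w‖ ^ n := h3
        _ ≤ _ := by gcongr
    exact le_of_mul_le_mul_right h4 (by positivity)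

lemma eq_zero_of_fourier_eq_zero (f : SchwartzMap (Ed k) ℂ)
    (h : ∀ w, 𝓕 (f : Ed k → ℂ) w = 0) (y : Ed k) : f y = 0 := by
  have h0 : 𝓕 (f : Ed k → ℂ) = 0 := funext h
  have h1 := f.continuous.fourierInv_fourier_eq (f.integrable (μ := volume))
    (by rw [h0]; exact integrable_zero _ _ _)
  rw [← h1, h0, Real.fourierInv_eq]
  simp

end FourierOnSubspace

section WaveFrontSetOfSubspace

open FourierTransform

variable {d k : ℕ}

lemma exists_linearIsometry_range_eq (V : Submodule ℝ (Ed d)) (hV : Module.finrank ℝ V = k) :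
    ∃ ι : Ed k →ₗᵢ[ℝ] Ed d, Set.range ι = (V : Set (Ed d)) := by
  let b := (stdOrthonormalBasis ℝ V).reindex (finCongr hV)
  refine ⟨V.subtypeₗᵢ.comp b.repr.symm.toLinearIsometry, ?_⟩
  ext x
  constructor
  · rintro ⟨y, rfl⟩
    exact (b.repr.symm y).2
  · intro hx
    exact ⟨b.repr ⟨x, hx⟩, by simp⟩

lemma exists_setIntegral_hausdorffMeasure_eq (k : ℕ) :
    ∃ c : ℝ, 0 < c ∧ ∀ {d : ℕ} (ι : Ed k →ₗᵢ[ℝ] Ed d) (g : Ed d → ℂ),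
      ∫ x in Set.range ι, g x ∂(μH[(k : ℝ)]) = c * ∫ y : Ed k, g (ι y) := by
  have hpos := Measure.addHaarScalarFactor_pos_of_isAddHaarMeasure
    (μH[(k : ℝ)] : Measure (Ed k)) (volume : Measure (Ed k))
  have heq :=
    Measure.isAddLeftInvariant_eq_smul (μH[(k : ℝ)] : Measure (Ed k)) (volume : Measure (Ed k))
  generalize Measure.addHaarScalarFactor (μH[(k : ℝ)] : Measure (Ed k)) volume = c at hpos heq
  refine ⟨c, NNReal.coe_pos.2 hpos, fun ι g => ?_⟩
  rw [← ι.isometry.map_hausdorffMeasure (Or.inl k.cast_nonneg),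
    ι.isometry.isClosedEmbedding.measurableEmbedding.integral_map, heq,
    integral_smul_nnreal_measure, NNReal.smul_def, Complex.real_smul]

lemma mem_range_iff_apply_isoAdjoint_eq (ι : Ed k →ₗᵢ[ℝ] Ed d) (x : Ed d) :
    x ∈ Set.range ι ↔ x - ι (isoAdjoint ι x) = 0 := by
  constructor
  · rintro ⟨y, rfl⟩
    rw [isoAdjoint_apply_self, sub_self]
  · intro h
    exact ⟨isoAdjoint ι x, (sub_eq_zero.1 h).symm⟩

lemma mem_orthogonal_iff_isoAdjoint_eq_zero (ι : Ed k →ₗᵢ[ℝ] Ed d) {V : Submodule ℝ (Ed d)}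
    (hι : Set.range ι = (V : Set (Ed d))) (ξ : Ed d) : ξ ∈ Vᗮ ↔ isoAdjoint ι ξ = 0 := by
  rw [Submodule.mem_orthogonal]
  constructor
  · intro h
    refine ext_inner_left ℝ fun y => ?_
    rw [inner_isoAdjoint, inner_zero_right]
    exact h _ (by rw [← SetLike.mem_coe, ← hι]; exact ⟨y, rfl⟩)
  · intro h v hv
    rw [← SetLike.mem_coe, ← hι] at hv
    obtain ⟨y, rfl⟩ := hv
    rw [← inner_isoAdjoint, h, inner_zero_right]

/-- The short-time Fourier transform of a distribution given by integration over the range of a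
linear isometry is a Fourier transform on the parameter space. -/
lemma IsSTFT.eq_fourier_restrictedWindow {u : TD d} {c : ℝ} (ι : Ed k →ₗᵢ[ℝ] Ed d)
    (hu : ∀ g : SchwartzMap (Ed d) ℂ, u g = c * ∫ y : Ed k, g (ι y))
    (f : SchwartzMap (Ed d) ℂ) {W : Ed d × Ed d → ℂ} (hW : IsSTFT u f W) (x ξ : Ed d) :
    W (x, ξ) =
      c * 𝓕 (restrictedWindow ι f x : Ed k → ℂ) ((2 * Real.pi)⁻¹ • isoAdjoint ι ξ) := by
  let g : SchwartzMap (Ed d) ℂ :=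
    SchwartzMap.smulLeftCLM ℂ (fun y : Ed d => Complex.exp (-(Complex.I * (⟪y, ξ⟫ : ℝ))))
      (restrictedWindow LinearIsometry.id f x)
  have hg : ∀ y, g y =
      (starRingEnd ℂ) (f (y - x)) * Complex.exp (-(Complex.I * (⟪y, ξ⟫ : ℝ))) := by
    intro y
    rw [SchwartzMap.smulLeftCLM_apply_apply (hasTemperateGrowth_cexp_neg_I_mul_inner ξ),
      restrictedWindow_apply, smul_eq_mul, mul_comm]
    rfl
  rw [hW x ξ g hg, hu, Real.fourier_eq']
  congr 1
  refine integral_congr_ae (Eventually.of_forall fun y => ?_)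
  simp only
  rw [hg, restrictedWindow_apply, smul_eq_mul, mul_comm, inner_smul_right, inner_isoAdjoint]
  congr 2
  have : (Real.pi : ℂ) ≠ 0 := by exact_mod_cast Real.pi_ne_zero
  push_cast
  field_simp

lemma norm_fourier_restrictedWindow_add (ι : Ed k →ₗᵢ[ℝ] Ed d) (f : SchwartzMap (Ed d) ℂ)
    (x : Ed d) (v w : Ed k) :
    ‖𝓕 (restrictedWindow ι f (x + ι v) : Ed k → ℂ) w‖ =
      ‖𝓕 (restrictedWindow ι f x : Ed k → ℂ) w‖ := by
  have h1 : (restrictedWindow ι f (x + ι v) : Ed k → ℂ) =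
      (restrictedWindow ι f x : Ed k → ℂ) ∘ fun y => y + -v := by
    funext y
    simp only [Function.comp_apply, restrictedWindow_apply, map_add, map_neg]
    congr 2
    abel
  have h2 := congrFun (VectorFourier.fourierIntegral_comp_add_right Real.fourierChar
    (volume : Measure (Ed k)) (innerₗ (Ed k)) (restrictedWindow ι f x : Ed k → ℂ) (-v)) w
  rw [h1]
  refine (congrArg norm h2).trans ?_
  rw [Circle.norm_smul]
  rfl

/-- A homogeneous function on phase space vanishing exactly on `range ι × (range ι)ᗮ`. -/
def rangeDefect (ι : Ed k →ₗᵢ[ℝ] Ed d) (z : Ed d × Ed d) : ℝ :=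
  max ‖z.1 - ι (isoAdjoint ι z.1)‖ ‖(2 * Real.pi)⁻¹ • isoAdjoint ι z.2‖

lemma continuous_rangeDefect (ι : Ed k →ₗᵢ[ℝ] Ed d) : Continuous (rangeDefect ι) := by
  have := ι.continuous
  unfold rangeDefect
  fun_prop

lemma rangeDefect_smul (ι : Ed k →ₗᵢ[ℝ] Ed d) {t : ℝ} (ht : 0 < t) (z : Ed d × Ed d) :
    rangeDefect ι (t • z) = t * rangeDefect ι z := by
  simp only [rangeDefect, Prod.smul_fst, Prod.smul_snd, map_smul, ← smul_sub]
  rw [smul_comm, norm_smul, norm_smul t, Real.norm_of_nonneg ht.le, mul_max_of_nonneg _ _ ht.le]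

lemma rangeDefect_nonneg (ι : Ed k →ₗᵢ[ℝ] Ed d) (z : Ed d × Ed d) : 0 ≤ rangeDefect ι z :=
  (norm_nonneg _).trans (le_max_left _ _)

lemma rangeDefect_eq_zero_iff (ι : Ed k →ₗᵢ[ℝ] Ed d) {V : Submodule ℝ (Ed d)}
    (hι : Set.range ι = (V : Set (Ed d))) (z : Ed d × Ed d) :
    rangeDefect ι z = 0 ↔ z.1 ∈ (V : Set (Ed d)) ∧ z.2 ∈ (Vᗮ : Set (Ed d)) := by
  rw [SetLike.mem_coe (p := Vᗮ), mem_orthogonal_iff_isoAdjoint_eq_zero ι hι, ← hι,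
    mem_range_iff_apply_isoAdjoint_eq]
  have hpi : (2 * Real.pi)⁻¹ ≠ 0 := by positivity
  constructor
  · intro h
    have h1 := (le_max_left _ _).trans h.le
    have h2 := (le_max_right _ _).trans h.le
    rw [norm_le_zero_iff] at h1 h2
    exact ⟨h1, (smul_eq_zero.1 h2).resolve_left hpi⟩
  · rintro ⟨h1, h2⟩
    simp [rangeDefect, h1, h2]

/-- Factorial bounds for the Fourier transforms of the restricted windows in terms of
`rangeDefect`. -/
lemma exists_rangeDefect_pow_mul_norm_le {s : ℝ} (hs : 0 < s) {f : SchwartzMap (Ed d) ℂ}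
    (hf : (f : Ed d → ℂ) ∈ SigmaGS s d) (ι : Ed k →ₗᵢ[ℝ] Ed d) {h : ℝ} (hh : 0 < h) :
    ∃ C : ℝ, 0 ≤ C ∧ ∀ (n : ℕ) (z : Ed d × Ed d),
      rangeDefect ι z ^ n * ‖𝓕 (restrictedWindow ι f z.1 : Ed k → ℂ)
        ((2 * Real.pi)⁻¹ • isoAdjoint ι z.2)‖ ≤ C * h ^ n * (n.factorial : ℝ) ^ s := by
  obtain ⟨C, hC0, hC⟩ := exists_norm_integral_le hs hf ι hh
  refine ⟨C, hC0, fun n z => ?_⟩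
  set w := (2 * Real.pi)⁻¹ • isoAdjoint ι z.2 with hw
  set F := 𝓕 (restrictedWindow ι f z.1 : Ed k → ℂ) w with hF
  have hnorm : ∀ y, ‖restrictedWindow ι f z.1 y‖ = ‖f (ι y - z.1)‖ := fun y => by
    rw [restrictedWindow_apply, RCLike.norm_conj]
  have h1 : ‖z.1 - ι (isoAdjoint ι z.1)‖ ^ n * ‖F‖ ≤ C * h ^ n * (n.factorial : ℝ) ^ s := by
    have hF' : ‖F‖ ≤ ∫ y, ‖restrictedWindow ι f z.1 y‖ :=
      VectorFourier.norm_fourierIntegral_le_integral_norm _ _ _ _ _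
    have := hC n 0 z.1
      (fun y => ‖z.1 - ι (isoAdjoint ι z.1)‖ ^ n * ‖restrictedWindow ι f z.1 y‖) fun y => by
        rw [Real.norm_of_nonneg (by positivity), norm_iteratedFDeriv_zero, hnorm]
        gcongr
        exact norm_sub_apply_isoAdjoint_le ι y z.1
    simp only [add_zero, Nat.factorial_zero, Nat.cast_one, mul_one] at this
    refine le_trans ?_ ((le_abs_self _).trans this)
    rw [integral_const_mul]
    gcongr
  have h2 : ‖w‖ ^ n * ‖F‖ ≤ C * h ^ n * (n.factorial : ℝ) ^ s := by
    have := hC 0 n z.1 (fun y => ‖iteratedFDeriv ℝ n (restrictedWindow ι f z.1) y‖) fun y => by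
      rw [norm_norm, pow_zero, one_mul]
      exact norm_iteratedFDeriv_restrictedWindow_le ι f z.1 n y
    simp only [zero_add, Nat.factorial_zero, Nat.cast_one, one_mul] at this
    exact (norm_pow_mul_norm_fourier_le _ n w).trans ((le_abs_self _).trans this)
  rcases max_choice ‖z.1 - ι (isoAdjoint ι z.1)‖ ‖w‖ with h | h
  · rwa [rangeDefect, ← hw, h]
  · rwa [rangeDefect, ← hw, h]

lemma pnorm_nonneg (z : Ed d × Ed d) : 0 ≤ pnorm z := Real.sqrt_nonneg _

lemma continuous_pnorm : Continuous (pnorm : Ed d × Ed d → ℝ) := by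
  unfold pnorm
  fun_prop

lemma pnorm_smul {t : ℝ} (ht : 0 < t) (z : Ed d × Ed d) : pnorm (t • z) = t * pnorm z := by
  rw [pnorm, Prod.smul_fst, Prod.smul_snd, norm_smul, norm_smul, Real.norm_of_nonneg ht.le,
    show (t * ‖z.1‖) ^ 2 + (t * ‖z.2‖) ^ 2 = t ^ 2 * (‖z.1‖ ^ 2 + ‖z.2‖ ^ 2) by ring,
    Real.sqrt_mul (sq_nonneg t), Real.sqrt_sq ht.le, pnorm]

lemma pnorm_pos {z : Ed d × Ed d} (hz : z ≠ 0) : 0 < pnorm z := by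
  refine Real.sqrt_pos.2 ?_
  by_contra hcon
  have h1 : ‖z.1‖ = 0 := by nlinarith [sq_nonneg ‖z.1‖, sq_nonneg ‖z.2‖]
  have h2 : ‖z.2‖ = 0 := by nlinarith [sq_nonneg ‖z.1‖, sq_nonneg ‖z.2‖]
  exact hz (Prod.ext (norm_eq_zero.1 h1) (norm_eq_zero.1 h2))

/-- A phase-space function with factorial decay in terms of `rangeDefect` has no wave front set
where `rangeDefect` does not vanish. -/
lemma rangeDefect_eq_zero_of_mem_WFs {s : ℝ} (hs : 0 < s) (ι : Ed k →ₗᵢ[ℝ] Ed d)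
    {W : Ed d × Ed d → ℂ}
    (hW : ∀ h : ℝ, 0 < h → ∃ C : ℝ, ∀ (n : ℕ) (z : Ed d × Ed d),
      rangeDefect ι z ^ n * ‖W z‖ ≤ C * h ^ n * (n.factorial : ℝ) ^ s)
    {z₀ : Ed d × Ed d} (hz₀ : z₀ ∈ WFs s W) : rangeDefect ι z₀ = 0 := by
  by_contra hne
  have hq : 0 < rangeDefect ι z₀ := lt_of_le_of_ne (rangeDefect_nonneg ι z₀) (Ne.symm hne)
  have hp : 0 < pnorm z₀ := pnorm_pos hz₀.1
  set ε := rangeDefect ι z₀ / (2 * pnorm z₀) with hε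
  have hε0 : 0 < ε := by positivity
  refine hz₀.2 ⟨{z | ε * pnorm z < rangeDefect ι z},
    isOpen_lt (continuous_pnorm.const_mul ε) (continuous_rangeDefect ι), ?_, ?_, ?_, ?_⟩
  · intro t ht z hz
    rw [Set.mem_ofPred_eq] at hz ⊢
    rw [pnorm_smul ht, rangeDefect_smul ι ht]
    nlinarith
  · simp [pnorm, rangeDefect]
  · rw [Set.mem_ofPred_eq, hε]
    field_simp
    norm_num
  · intro A hA
    obtain ⟨C, hC⟩ := exists_exp_mul_le_of_pow_mul_le hs
      (fun z : {z | ε * pnorm z < rangeDefect ι z} => pnorm z.1) (fun z => ‖W z.1‖)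
      (fun z => pnorm_nonneg _) (fun z => norm_nonneg _) (fun h hh => by
        obtain ⟨C, hC⟩ := hW (ε * h) (by positivity)
        refine ⟨C, fun z n => ?_⟩
        have h1 : ε ^ n * (pnorm z.1 ^ n * ‖W z.1‖) ≤
            ε ^ n * (C * h ^ n * (n.factorial : ℝ) ^ s) :=
          calc ε ^ n * (pnorm z.1 ^ n * ‖W z.1‖) = (ε * pnorm z.1) ^ n * ‖W z.1‖ := by ring
            _ ≤ rangeDefect ι z.1 ^ n * ‖W z.1‖ := by
              have := pnorm_nonneg z.1
              have : ε * pnorm z.1 ≤ rangeDefect ι z.1 := le_of_lt z.2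
              gcongr
            _ ≤ C * (ε * h) ^ n * (n.factorial : ℝ) ^ s := hC n z.1
            _ = _ := by ring
        exact le_of_mul_le_mul_left h1 (by positivity)) A hA
    exact ⟨C, fun z hz => hC ⟨z, hz⟩⟩

/-- If the modulus of a nonzero function is invariant under translations along `z₀`, then `z₀`
belongs to the wave front set. -/
lemma mem_WFs_of_norm_add_smul_eq {s : ℝ} (hs : 0 < s) {W : Ed d × Ed d → ℂ}
    {z₀ : Ed d × Ed d} (hz₀ : z₀ ≠ 0) (hinv : ∀ z (t : ℝ), ‖W (z + t • z₀)‖ = ‖W z‖)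
    {z₁ : Ed d × Ed d} (hz₁ : W z₁ ≠ 0) : z₀ ∈ WFs s W := by
  refine ⟨hz₀, ?_⟩
  rintro ⟨Γ, hΓo, hΓc, -, hmem, hΓ⟩
  obtain ⟨C, hC⟩ := hΓ 1 one_pos
  have hlim : Tendsto (fun t : ℝ => z₀ + t⁻¹ • z₁) atTop (nhds z₀) := by
    simpa using (tendsto_const_nhds (x := z₀)).add
      ((tendsto_inv_atTop_zero (𝕜 := ℝ)).smul_const z₁)
  have hp : Tendsto (fun t : ℝ => pnorm (z₀ + t⁻¹ • z₁)) atTop (nhds (pnorm z₀)) :=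
    (continuous_pnorm.tendsto z₀).comp hlim
  have hp' : Tendsto (fun t : ℝ => t * pnorm (z₀ + t⁻¹ • z₁)) atTop atTop :=
    tendsto_id.atTop_mul_pos (pnorm_pos hz₀) hp
  have hexp : Tendsto (fun t : ℝ =>
      Real.exp ((t * pnorm (z₀ + t⁻¹ • z₁)) ^ (1 / s)) * ‖W z₁‖) atTop atTop :=
    (Real.tendsto_exp_atTop.comp
      ((tendsto_rpow_atTop (by positivity)).comp hp')).atTop_mul_const (norm_pos_iff.2 hz₁)
  obtain ⟨t, ⟨ht1, ht2⟩, ht0⟩ := (((hexp.eventually_gt_atTop C).and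
    (hlim.eventually (hΓo.mem_nhds hmem))).and (eventually_gt_atTop 0)).exists
  have h1 : t • (z₀ + t⁻¹ • z₁) = z₁ + t • z₀ := by
    rw [smul_add, smul_smul, mul_inv_cancel₀ ht0.ne', one_smul, add_comm]
  have h2 := hC _ (hΓc t ht0 _ ht2)
  rw [pnorm_smul ht0, one_mul, h1, hinv] at h2
  exact absurd h2 (not_le.2 ht1)

end WaveFrontSetOfSubspace

theorem statement14 (d k : ℕ) (s : ℝ) (hs : 1/2 < s) (hk : k ≤ d)
    (V : Submodule ℝ (Ed d)) (hV : Module.finrank ℝ V = k)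
    (u : TD d)
    (hu : ∀ g : SchwartzMap (Ed d) ℂ, u g = ∫ x in (V : Set (Ed d)), g x ∂(μH[(k : ℝ)]))
    (φ : Ed d → ℂ) (hφ : φ ∈ SigmaGS s d) (hφ0 : φ ≠ 0)
    (W : Ed d × Ed d → ℂ) (hW : IsSTFT u φ W) :
    WFs s W =
      {z : Ed d × Ed d | z.1 ∈ (V : Set (Ed d)) ∧ z.2 ∈ (Vᗮ : Set (Ed d))} \ {0} := by
  have hs0 : 0 < s := by linarith
  obtain ⟨ι, hι⟩ := exists_linearIsometry_range_eq V hV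
  obtain ⟨c, hc, hsetint⟩ := exists_setIntegral_hausdorffMeasure_eq k
  obtain ⟨f, rfl⟩ : ∃ f : SchwartzMap (Ed d) ℂ, (f : Ed d → ℂ) = φ :=
    ⟨SigmaGS.toSchwartz hs0 hφ, SigmaGS.coe_toSchwartz hs0 hφ⟩
  have hWf := IsSTFT.eq_fourier_restrictedWindow ι
    (fun g => by rw [hu, ← hι, hsetint ι]) f hW
  have hWn : ∀ z, ‖W z‖ = c * ‖FourierTransform.fourier (restrictedWindow ι f z.1 : Ed k → ℂ)
      ((2 * Real.pi)⁻¹ • isoAdjoint ι z.2)‖ := fun z => by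
    rw [← Prod.mk.eta (p := z), hWf, norm_mul, Complex.norm_real, Real.norm_of_nonneg hc.le]
  ext z₀
  constructor
  · intro hz₀
    refine ⟨(rangeDefect_eq_zero_iff ι hι z₀).1
      (rangeDefect_eq_zero_of_mem_WFs hs0 ι (fun h hh => ?_) hz₀), hz₀.1⟩
    obtain ⟨C, -, hC⟩ := exists_rangeDefect_pow_mul_norm_le hs0 hφ ι hh
    refine ⟨c * C, fun n z => ?_⟩
    rw [hWn, mul_left_comm, mul_assoc c, mul_assoc c]
    exact mul_le_mul_of_nonneg_left (hC n z) hc.le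
  · rintro ⟨⟨h1, h2⟩, hz₀⟩
    rw [← hι] at h1
    obtain ⟨v, hv⟩ := h1
    have h2' := (mem_orthogonal_iff_isoAdjoint_eq_zero ι hι z₀.2).1 h2
    obtain ⟨z₁, hz₁⟩ : ∃ z₁, W z₁ ≠ 0 := by
      by_contra! hW0
      refine hφ0 (funext fun x => ?_)
      have h0 : ∀ w, FourierTransform.fourier (restrictedWindow ι f (-x) : Ed k → ℂ) w = 0 := by
        intro w
        have h3 := hWn (-x, (2 * Real.pi) • ι w)
        rw [hW0, norm_zero, map_smul, isoAdjoint_apply_self,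
          inv_smul_smul₀ (by positivity)] at h3
        exact norm_eq_zero.1 ((mul_eq_zero.1 h3.symm).resolve_left hc.ne')
      have h4 := eq_zero_of_fourier_eq_zero _ h0 0
      rwa [restrictedWindow_apply, map_zero, zero_sub, neg_neg, map_eq_zero] at h4
    refine mem_WFs_of_norm_add_smul_eq hs0 hz₀ (fun z t => ?_) hz₁
    rw [hWn, hWn, Prod.fst_add, Prod.snd_add, Prod.smul_fst, Prod.smul_snd, map_add, map_smul,
      h2', smul_zero, add_zero, ← hv, ← map_smul, norm_fourier_restrictedWindow_add]

end
end

section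
/- Let s > 1/2, let φ ∈ Σ_s(ℝ^{2d}), and let a ∈ C^∞(ℝ^{2d}) be such that for every h > 0 there exists C_h > 0 with |∂^α a(z)| ≤ C_h h^{|α|} (α!)^s for all α ∈ ℕ^{2d} and z ∈ ℝ^{2d}. Then for every A > 0 there exists C_A > 0 such that |V_φ a(x,ξ)| ≤ C_A e^{−A|ξ|^{1/s}} for all x ∈ ℝ^{2d} and ξ ∈ ℝ^{2d}. -/
open MeasureTheory Filter
open scoped BigOperators ENNReal RealInnerProductSpace

noncomputable section

theorem foldr_comp_ofFn_of_eq_id {X : Type*} {n : ℕ} (g : Fin n → X → X) (hg : ∀ i, g i = id) :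
    (List.ofFn g).foldr (· ∘ ·) id = id := by
  induction n with
  | zero => simp
  | succ n ih =>
    rw [List.ofFn_succ, List.foldr_cons, ih _ fun i => hg i.succ, hg 0]
    rfl

theorem foldr_comp_ofFn_of_eq_id_off {X : Type*} {n : ℕ} (g : Fin n → X → X) (j : Fin n)
    (hg : ∀ i, i ≠ j → g i = id) : (List.ofFn g).foldr (· ∘ ·) id = g j := by
  induction n with
  | zero => exact j.elim0
  | succ n ih =>
    rw [List.ofFn_succ, List.foldr_cons]
    induction j using Fin.cases with
    | zero =>
      rw [foldr_comp_ofFn_of_eq_id _ fun i => hg i.succ (Fin.succ_ne_zero i)]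
      rfl
    | succ j =>
      rw [ih _ j fun i hi => hg i.succ (by simpa using hi), hg 0 (Fin.succ_ne_zero j).symm]
      rfl

theorem mderiv_single {d : ℕ} (j : Fin d) (k : ℕ) (f : Ed d → ℂ) :
    mderiv (Pi.single j k) f = (pdGS j)^[k] f := by
  unfold mderiv
  rw [foldr_comp_ofFn_of_eq_id_off _ j]
  · simp
  · intro i hi
    simp [Pi.single_eq_of_ne hi]

theorem mlen_single {d : ℕ} (j : Fin d) (k : ℕ) : mlen (Pi.single j k) = k := by
  simp [mlen]

theorem mfact_single {d : ℕ} (j : Fin d) (k : ℕ) : mfact (Pi.single j k) = k.factorial := by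
  unfold mfact
  rw [Finset.prod_eq_single j]
  · simp
  · intro i _ hi
    simp [Pi.single_eq_of_ne hi]
  · simp

theorem mpow_single {d : ℕ} (x : Ed d) (j : Fin d) (k : ℕ) : mpow x (Pi.single j k) = x j ^ k := by
  unfold mpow
  rw [Finset.prod_eq_single j]
  · simp
  · intro i _ hi
    simp [Pi.single_eq_of_ne hi]
  · simp

theorem contDiff_pdGS {d : ℕ} (j : Fin d) {f : Ed d → ℂ}
    (hf : ContDiff ℝ ((⊤ : ℕ∞) : WithTop ℕ∞) f) :
    ContDiff ℝ ((⊤ : ℕ∞) : WithTop ℕ∞) (pdGS j f) :=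
  (hf.fderiv_right (m := ((⊤ : ℕ∞) : WithTop ℕ∞)) le_rfl).clm_apply contDiff_const

theorem contDiff_iterate_pdGS {d : ℕ} (j : Fin d) {f : Ed d → ℂ}
    (hf : ContDiff ℝ ((⊤ : ℕ∞) : WithTop ℕ∞) f) (k : ℕ) :
    ContDiff ℝ ((⊤ : ℕ∞) : WithTop ℕ∞) ((pdGS j)^[k] f) := by
  induction k with
  | zero => exact hf
  | succ k ih =>
    rw [Function.iterate_succ_apply']
    exact contDiff_pdGS j ih

theorem iteratedDeriv_comp_line {d : ℕ} (j : Fin d) {f : Ed d → ℂ}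
    (hf : ContDiff ℝ ((⊤ : ℕ∞) : WithTop ℕ∞) f) (x : Ed d) (k : ℕ) :
    iteratedDeriv k (fun t : ℝ => f (x + t • EuclideanSpace.single j (1 : ℝ))) =
      fun t => (pdGS j)^[k] f (x + t • EuclideanSpace.single j (1 : ℝ)) := by
  induction k with
  | zero => simp
  | succ k ih =>
    rw [iteratedDeriv_succ, ih, Function.iterate_succ_apply']
    ext t
    have h1 : HasFDerivAt ((pdGS j)^[k] f) _ (x + t • EuclideanSpace.single j (1 : ℝ)) :=
      ((contDiff_iterate_pdGS j hf k).differentiable (by simp) _).hasFDerivAt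
    have h2 : HasDerivAt (fun t : ℝ => x + t • EuclideanSpace.single j (1 : ℝ))
        (EuclideanSpace.single j (1 : ℝ)) t := by
      simpa using ((hasDerivAt_id t).smul_const (EuclideanSpace.single j (1 : ℝ))).const_add x
    exact (h1.comp_hasDerivAt t h2).deriv

theorem norm_iterate_pdGS_mul_le {d : ℕ} (j : Fin d) {f g : Ed d → ℂ}
    (hf : ContDiff ℝ ((⊤ : ℕ∞) : WithTop ℕ∞) f) (hg : ContDiff ℝ ((⊤ : ℕ∞) : WithTop ℕ∞) g)
    (N : ℕ) (x : Ed d) :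
    ‖(pdGS j)^[N] (fun y => f y * g y) x‖ ≤ ∑ k ∈ Finset.range (N + 1),
      (N.choose k : ℝ) * ‖(pdGS j)^[k] f x‖ * ‖(pdGS j)^[N - k] g x‖ := by
  have hl : ContDiff ℝ ((⊤ : ℕ∞) : WithTop ℕ∞)
      (fun t : ℝ => x + t • EuclideanSpace.single j (1 : ℝ)) := by fun_prop
  have key := norm_iteratedFDeriv_mul_le (hf.comp hl) (hg.comp hl) (0 : ℝ) (n := N)
    (by exact_mod_cast le_top)
  simp only [norm_iteratedFDeriv_eq_norm_iteratedDeriv, Function.comp_def,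
    iteratedDeriv_comp_line j hf, iteratedDeriv_comp_line j hg,
    iteratedDeriv_comp_line j (hf.mul hg)] at key
  simpa using key

theorem iterate_pdGS_conj_comp_sub {d : ℕ} (j : Fin d) (f : Ed d → ℂ) (x : Ed d) (k : ℕ) :
    (pdGS j)^[k] (fun y => (starRingEnd ℂ) (f (y - x))) =
      fun y => (starRingEnd ℂ) ((pdGS j)^[k] f (y - x)) := by
  induction k with
  | zero => rfl
  | succ k ih =>
    rw [Function.iterate_succ_apply', ih, Function.iterate_succ_apply']
    ext y
    have h := Complex.conjCLE.comp_fderiv (f := fun y => (pdGS j)^[k] f (y - x)) (x := y)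
    rw [fderiv_comp_sub] at h
    have h' := congrArg (fun L => L (EuclideanSpace.single j (1 : ℝ))) h
    simpa [pdGS, Function.comp_def] using h'

theorem norm_le_sum_abs {d : ℕ} (x : Ed d) : ‖x‖ ≤ ∑ i, |x i| := by
  rw [EuclideanSpace.norm_eq]
  refine Real.sqrt_le_iff.2 ⟨by positivity, ?_⟩
  simpa using Finset.sum_sq_le_sq_sum_of_nonneg (s := Finset.univ) (f := fun i => |x i|)
    fun i _ => abs_nonneg _

/-- A vector is controlled by its largest coordinate. -/
theorem exists_norm_le_mul_abs {d : ℕ} [NeZero d] (x : Ed d) : ∃ j, ‖x‖ ≤ d * |x j| := by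
  obtain ⟨j, -, hj⟩ := Finset.exists_max_image Finset.univ (fun i => |x i|) ⟨0, Finset.mem_univ _⟩
  refine ⟨j, (norm_le_sum_abs x).trans ?_⟩
  simpa using Finset.sum_le_card_nsmul Finset.univ (fun i => |x i|) _ hj

theorem exists_bound_of_GSnorm_lt_top {d : ℕ} {s h : ℝ} (hh : 0 < h) {f : Ed d → ℂ}
    (hf : GSnorm s h f < ⊤) : ∃ C : ℝ, 0 ≤ C ∧ ∀ (x : Ed d) (α β : Fin d → ℕ),
      |mpow x α| * ‖mderiv β f x‖ ≤
        C * (h ^ (mlen α + mlen β) * ((mfact α : ℝ) * (mfact β : ℝ)) ^ s) := by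
  refine ⟨(GSnorm s h f).toReal, ENNReal.toReal_nonneg, fun x α β => ?_⟩
  have hpos : ∀ γ : Fin d → ℕ, (0 : ℝ) < mfact γ := fun γ => by
    exact_mod_cast Finset.prod_pos fun i _ => Nat.factorial_pos _
  have hα := hpos α
  have hβ := hpos β
  rw [← div_le_iff₀ (by positivity), ← ENNReal.ofReal_le_iff_le_toReal hf.ne]
  exact le_iSup_of_le x (le_iSup_of_le α (le_iSup_of_le β le_rfl))

theorem exists_decay_of_GSnorm_lt_top {d : ℕ} [NeZero d] {s h : ℝ} (hh : 0 < h) {f : Ed d → ℂ}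
    (hf : GSnorm s h f < ⊤) (K : ℕ) : ∃ C : ℝ, 0 ≤ C ∧ ∀ (j : Fin d) (k : ℕ) (x : Ed d),
      ‖(pdGS j)^[k] f x‖ ≤ C * h ^ k * (k.factorial : ℝ) ^ s * (1 + ‖x‖) ^ (-(K : ℝ)) := by
  obtain ⟨C, hC, hb⟩ := exists_bound_of_GSnorm_lt_top hh hf
  refine ⟨(d + 1) ^ K * (C * (1 + h ^ K * (K.factorial : ℝ) ^ s)), by positivity,
    fun j k x => ?_⟩
  rw [Real.rpow_neg (by positivity), Real.rpow_natCast, ← div_eq_mul_inv,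
    le_div_iff₀ (by positivity)]
  have hk : (0 : ℝ) ≤ (k.factorial : ℝ) ^ s := by positivity
  have hK : (0 : ℝ) ≤ (K.factorial : ℝ) ^ s := by positivity
  have hhk : (0 : ℝ) ≤ h ^ k := by positivity
  have hhK : (0 : ℝ) ≤ h ^ K := by positivity
  obtain ⟨l, hl⟩ := exists_norm_le_mul_abs x
  rcases le_total |x l| 1 with h1 | h1
  · have h0 := hb x (Pi.single j 0) (Pi.single j k)
    simp only [mpow_single, mderiv_single, mlen_single, mfact_single, pow_zero, abs_one, one_mul,
      Nat.factorial_zero, Nat.cast_one, zero_add] at h0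
    have h2 : (1 + ‖x‖) ^ K ≤ ((d : ℝ) + 1) ^ K := by
      refine pow_le_pow_left₀ (by positivity) ?_ K
      nlinarith [(Nat.cast_nonneg d : (0 : ℝ) ≤ d)]
    calc _ ≤ (C * (h ^ k * (k.factorial : ℝ) ^ s)) * ((d : ℝ) + 1) ^ K := by gcongr
      _ ≤ (C * (h ^ k * (k.factorial : ℝ) ^ s)) * ((d : ℝ) + 1) ^ K *
          (1 + h ^ K * (K.factorial : ℝ) ^ s) :=
        le_mul_of_one_le_right (by positivity) (by nlinarith [mul_nonneg hhK hK])
      _ = _ := by ring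
  · have h0 := hb x (Pi.single l K) (Pi.single j k)
    simp only [mpow_single, mderiv_single, mlen_single, mfact_single, abs_pow] at h0
    rw [Real.mul_rpow (by positivity) (by positivity), pow_add] at h0
    have h2 : (1 + ‖x‖) ^ K ≤ ((d : ℝ) + 1) ^ K * |x l| ^ K := by
      rw [← mul_pow]
      gcongr
      nlinarith
    calc _ ≤ ‖(pdGS j)^[k] f x‖ * (((d : ℝ) + 1) ^ K * |x l| ^ K) := by gcongr
      _ = ((d : ℝ) + 1) ^ K * (|x l| ^ K * ‖(pdGS j)^[k] f x‖) := by ring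
      _ ≤ ((d : ℝ) + 1) ^ K * (C * (h ^ K * h ^ k *
          ((K.factorial : ℝ) ^ s * (k.factorial : ℝ) ^ s))) := by gcongr
      _ = ((d : ℝ) + 1) ^ K * (C * (h ^ K * (K.factorial : ℝ) ^ s)) *
          h ^ k * (k.factorial : ℝ) ^ s := by ring
      _ ≤ _ := by
        gcongr
        linarith

theorem pow_abs_mul_norm_integral_mul_exp {d : ℕ} (j : Fin d) (ξ : Ed d) {F : Ed d → ℂ}
    (hF : ContDiff ℝ ((⊤ : ℕ∞) : WithTop ℕ∞) F) (hint : ∀ k, Integrable ((pdGS j)^[k] F))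
    (N : ℕ) :
    |ξ j| ^ N * ‖∫ y, F y * Complex.exp (-(Complex.I * (⟪y, ξ⟫ : ℝ)))‖ =
      ‖∫ y, (pdGS j)^[N] F y * Complex.exp (-(Complex.I * (⟪y, ξ⟫ : ℝ)))‖ := by
  set e : Ed d → ℂ := fun y => Complex.exp (-(Complex.I * (⟪y, ξ⟫ : ℝ))) with he
  have hed : ∀ y, HasFDerivAt e
      (Complex.exp (-(Complex.I * (⟪y, ξ⟫ : ℝ))) •
        (-(Complex.I • (Complex.ofRealCLM.comp (innerSL ℝ ξ))))) y := fun y => by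
    have h1 : HasFDerivAt (fun y : Ed d => ((⟪y, ξ⟫ : ℝ) : ℂ))
        (Complex.ofRealCLM.comp (innerSL ℝ ξ)) y := by
      have := (Complex.ofRealCLM.comp (innerSL ℝ ξ)).hasFDerivAt (x := y)
      refine this.congr_of_eventuallyEq (Eventually.of_forall fun z => ?_)
      simp [real_inner_comm]
    exact ((h1.const_mul Complex.I).neg).cexp
  have hed' : ∀ y, fderiv ℝ e y (EuclideanSpace.single j 1) = -(Complex.I * ξ j) * e y := fun y => by
    rw [(hed y).fderiv]
    simp [he, EuclideanSpace.inner_single_right]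
    ring
  have hen : ∀ y, ‖e y‖ = 1 := fun y => by
    simp [he, Complex.norm_exp]
  have hec : Continuous e := continuous_iff_continuousAt.2 fun y => (hed y).continuousAt
  have hie : ∀ G : Ed d → ℂ, Integrable G → Integrable fun y => G y * e y := fun G hG =>
    hG.mul_bdd (c := 1) hec.aestronglyMeasurable (Eventually.of_forall fun y => (hen y).le)
  induction N with
  | zero => simp
  | succ N ih =>
    have hN1 := hint (N + 1)
    rw [Function.iterate_succ_apply'] at hN1
    have hN := integral_mul_fderiv_eq_neg_fderiv_mul_of_integrable (μ := volume)
      (f := (pdGS j)^[N] F) (g := e) (v := EuclideanSpace.single j (1 : ℝ))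
      (hie _ hN1)
      (by
        simp only [hed']
        simpa only [mul_left_comm] using (hie _ (hint N)).const_mul (-(Complex.I * ξ j)))
      (hie _ (hint N))
      (fun y _ => (contDiff_iterate_pdGS j hF N).differentiable (by simp) y)
      (fun y _ => (hed y).differentiableAt)
    simp only [hed', mul_left_comm _ (-(Complex.I * (ξ j : ℂ)))] at hN
    rw [integral_const_mul] at hN
    have hN' := congrArg norm hN
    rw [norm_neg, norm_mul] at hN'
    simp only [Function.iterate_succ_apply']
    rw [pow_succ', mul_assoc, ih]
    simpa [pdGS] using hN'

/-- Factorial bounds on all moments give stretched exponential decay. -/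
theorem le_exp_neg_of_forall_pow_mul_le {s A q C r V : ℝ} (hs : 0 < s) (hA : 0 < A) (hq : 0 ≤ q)
    (hC : 0 ≤ C) (hr : 0 ≤ r) (hV : 0 ≤ V) (hAq : A / s * q ^ (1 / s) ≤ 1 / 2)
    (h : ∀ N : ℕ, r ^ N * V ≤ C * q ^ N * (N.factorial : ℝ) ^ s) :
    V ≤ 2 ^ s * C * Real.exp (-(A * r ^ (1 / s))) := by
  have hs' : 0 ≤ 1 / s := by positivity
  have hroot : ∀ N : ℕ, (r ^ (1 / s)) ^ N * V ^ (1 / s) ≤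
      C ^ (1 / s) * (q ^ (1 / s)) ^ N * N.factorial := fun N => by
    have := Real.rpow_le_rpow (by positivity) (h N) hs'
    rwa [Real.mul_rpow (by positivity) hV, Real.mul_rpow (by positivity) (by positivity),
      Real.mul_rpow hC (by positivity), ← Real.rpow_mul (by positivity), mul_one_div_cancel hs.ne',
      Real.rpow_one, ← Real.rpow_natCast, ← Real.rpow_natCast, ← Real.rpow_mul hr,
      ← Real.rpow_mul hq, mul_comm (N : ℝ), Real.rpow_mul hr, Real.rpow_mul hq,
      Real.rpow_natCast, Real.rpow_natCast] at this
  have hexp : HasSum (fun N : ℕ => (A / s * r ^ (1 / s)) ^ N / (N.factorial : ℝ))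
      (Real.exp (A / s * r ^ (1 / s))) := by
    rw [Real.exp_eq_exp_ℝ]
    exact NormedSpace.expSeries_div_hasSum_exp _
  have hle : Real.exp (A / s * r ^ (1 / s)) * V ^ (1 / s) ≤ C ^ (1 / s) * 2 := by
    refine hasSum_le (fun N => ?_) (hexp.mul_right _) (hasSum_geometric_two.mul_left _)
    rw [div_mul_eq_mul_div, div_le_iff₀ (by positivity), mul_pow]
    calc _ = (A / s) ^ N * ((r ^ (1 / s)) ^ N * V ^ (1 / s)) := by ring
      _ ≤ (A / s) ^ N * (C ^ (1 / s) * (q ^ (1 / s)) ^ N * N.factorial) :=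
        mul_le_mul_of_nonneg_left (hroot N) (by positivity)
      _ = C ^ (1 / s) * (A / s * q ^ (1 / s)) ^ N * N.factorial := by ring
      _ ≤ _ := by gcongr
  have hpow := Real.rpow_le_rpow (by positivity) hle hs.le
  rw [Real.mul_rpow (by positivity) (by positivity), Real.mul_rpow (by positivity) (by positivity),
    ← Real.rpow_mul hV, ← Real.rpow_mul hC, one_div_mul_cancel hs.ne', Real.rpow_one,
    Real.rpow_one, ← Real.exp_mul, mul_right_comm, div_mul_cancel₀ _ hs.ne'] at hpow
  rw [Real.exp_neg, ← div_eq_mul_inv, le_div_iff₀ (Real.exp_pos _)]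
  linarith

theorem norm_iterate_pdGS_mul_conj_le {d : ℕ} {s h Ca Cφ w : ℝ} (hs : 0 ≤ s) (hh : 0 ≤ h)
    (hCa : 0 ≤ Ca) (j : Fin d) {a φ : Ed d → ℂ}
    (ha : ContDiff ℝ ((⊤ : ℕ∞) : WithTop ℕ∞) a) (hφ : ContDiff ℝ ((⊤ : ℕ∞) : WithTop ℕ∞) φ)
    (x y : Ed d) (hab : ∀ k : ℕ, ‖(pdGS j)^[k] a y‖ ≤ Ca * h ^ k * (k.factorial : ℝ) ^ s)
    (hφb : ∀ k : ℕ, ‖(pdGS j)^[k] φ (y - x)‖ ≤ Cφ * h ^ k * (k.factorial : ℝ) ^ s * w)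
    (hw : 0 ≤ Cφ * w) (N : ℕ) :
    ‖(pdGS j)^[N] (fun y => a y * (starRingEnd ℂ) (φ (y - x))) y‖ ≤
      Ca * Cφ * (2 * h) ^ N * (N.factorial : ℝ) ^ s * w := by
  have hφ' : ContDiff ℝ ((⊤ : ℕ∞) : WithTop ℕ∞) (fun y => (starRingEnd ℂ) (φ (y - x))) :=
    Complex.conjCLE.contDiff.comp (hφ.comp (contDiff_id.sub contDiff_const))
  refine (norm_iterate_pdGS_mul_le j ha hφ' N y).trans ?_
  have hterm : ∀ k ∈ Finset.range (N + 1), (N.choose k : ℝ) * ‖(pdGS j)^[k] a y‖ *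
      ‖(pdGS j)^[N - k] (fun y => (starRingEnd ℂ) (φ (y - x))) y‖ ≤
      N.choose k * (Ca * (Cφ * w) * h ^ N * (N.factorial : ℝ) ^ s) := fun k hk => by
    have hkN : k ≤ N := Nat.lt_succ_iff.1 (Finset.mem_range.1 hk)
    rw [iterate_pdGS_conj_comp_sub, RCLike.norm_conj, mul_assoc]
    have hfact : (k.factorial : ℝ) ^ s * ((N - k).factorial : ℝ) ^ s ≤ (N.factorial : ℝ) ^ s := by
      rw [← Real.mul_rpow (by positivity) (by positivity)]
      refine Real.rpow_le_rpow (by positivity) ?_ hs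
      exact_mod_cast Nat.le_of_dvd N.factorial_pos (Nat.factorial_mul_factorial_dvd_factorial hkN)
    refine mul_le_mul_of_nonneg_left ?_ (by positivity)
    calc _ ≤ (Ca * h ^ k * (k.factorial : ℝ) ^ s) *
          (Cφ * h ^ (N - k) * ((N - k).factorial : ℝ) ^ s * w) :=
          mul_le_mul (hab k) (hφb _) (norm_nonneg _) (by positivity)
      _ = Ca * (Cφ * w) * (h ^ k * h ^ (N - k)) *
          ((k.factorial : ℝ) ^ s * ((N - k).factorial : ℝ) ^ s) := by ring
      _ ≤ Ca * (Cφ * w) * (h ^ k * h ^ (N - k)) * (N.factorial : ℝ) ^ s := by gcongr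
      _ = _ := by rw [← pow_add, Nat.add_sub_cancel' hkN]
  refine (Finset.sum_le_sum hterm).trans_eq ?_
  rw [← Finset.sum_mul, ← Nat.cast_sum, Nat.sum_range_choose, mul_pow]
  push_cast
  ring

theorem exists_norm_pow_mul_STFTgs_le {d : ℕ} [NeZero d] {s h Ca : ℝ} (hs : 0 ≤ s) (hh : 0 < h)
    (hCa : 0 ≤ Ca) {a φ : Ed d → ℂ}
    (ha : ContDiff ℝ ((⊤ : ℕ∞) : WithTop ℕ∞) a) (hφ : ContDiff ℝ ((⊤ : ℕ∞) : WithTop ℕ∞) φ)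
    (hab : ∀ (α : Fin d → ℕ) (z : Ed d),
      ‖mderiv α a z‖ ≤ Ca * h ^ mlen α * (mfact α : ℝ) ^ s)
    (hφb : GSnorm s h φ < ⊤) : ∃ C : ℝ, 0 ≤ C ∧ ∀ (x ξ : Ed d) (N : ℕ),
      ‖ξ‖ ^ N * ‖STFTgs φ a (x, ξ)‖ ≤ C * (d * (2 * h)) ^ N * (N.factorial : ℝ) ^ s := by
  obtain ⟨Cφ, hCφ, hdecay⟩ := exists_decay_of_GSnorm_lt_top hh hφb (d + 1)
  set w : Ed d → ℝ := fun y => (1 + ‖y‖) ^ (-((d + 1 : ℕ) : ℝ)) with hw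
  have hw0 : ∀ y, 0 ≤ w y := fun y => by positivity
  have hwint : Integrable w := integrable_one_add_norm (by simp)
  refine ⟨Ca * Cφ * ∫ y, w y, mul_nonneg (by positivity) (integral_nonneg hw0), fun x ξ N => ?_⟩
  obtain ⟨j, hj⟩ := exists_norm_le_mul_abs ξ
  set F : Ed d → ℂ := fun y => a y * (starRingEnd ℂ) (φ (y - x)) with hF
  have hFd : ContDiff ℝ ((⊤ : ℕ∞) : WithTop ℕ∞) F :=
    ha.mul (Complex.conjCLE.contDiff.comp (hφ.comp (contDiff_id.sub contDiff_const)))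
  have haj : ∀ (y : Ed d) (k : ℕ),
      ‖(pdGS j)^[k] a y‖ ≤ Ca * h ^ k * (k.factorial : ℝ) ^ s := fun y k => by
    have := hab (Pi.single j k) y
    rwa [mderiv_single, mlen_single, mfact_single] at this
  have hFb : ∀ (k : ℕ) (y : Ed d), ‖(pdGS j)^[k] F y‖ ≤
      Ca * Cφ * (2 * h) ^ k * (k.factorial : ℝ) ^ s * w (y - x) := fun k y =>
    norm_iterate_pdGS_mul_conj_le hs hh.le hCa j ha hφ x y (haj y)
      (fun k => hdecay j k (y - x)) (mul_nonneg hCφ (hw0 _)) k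
  have hbint : ∀ k : ℕ, Integrable fun y =>
      Ca * Cφ * (2 * h) ^ k * (k.factorial : ℝ) ^ s * w (y - x) := fun k =>
    (hwint.comp_sub_right x).const_mul _
  have hint : ∀ k, Integrable ((pdGS j)^[k] F) := fun k =>
    (hbint k).mono' (contDiff_iterate_pdGS j hFd k).continuous.aestronglyMeasurable
      (Eventually.of_forall (hFb k))
  have hmain : |ξ j| ^ N * ‖STFTgs φ a (x, ξ)‖ ≤
      Ca * Cφ * (2 * h) ^ N * (N.factorial : ℝ) ^ s * ∫ y, w y := by
    refine (pow_abs_mul_norm_integral_mul_exp j ξ hFd hint N).trans_le ?_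
    rw [← integral_sub_right_eq_self w x, ← integral_const_mul]
    refine norm_integral_le_of_norm_le (hbint N) (Eventually.of_forall fun y => ?_)
    simpa [Complex.norm_exp] using hFb N y
  calc _ ≤ (d * |ξ j|) ^ N * ‖STFTgs φ a (x, ξ)‖ := by gcongr
    _ = (d : ℝ) ^ N * (|ξ j| ^ N * ‖STFTgs φ a (x, ξ)‖) := by ring
    _ ≤ (d : ℝ) ^ N * (Ca * Cφ * (2 * h) ^ N * (N.factorial : ℝ) ^ s * ∫ y, w y) := by gcongr
    _ = _ := by ring

theorem statement15 (d : ℕ) (s : ℝ) (hs : 1/2 < s)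
    (φ : Ed (2*d) → ℂ) (hφ : φ ∈ SigmaGS s (2*d))
    (a : Ed (2*d) → ℂ) (ha : ContDiff ℝ ((⊤ : ℕ∞) : WithTop ℕ∞) a)
    (hest : ∀ h : ℝ, 0 < h → ∃ Ch : ℝ, 0 < Ch ∧ ∀ (α : Fin (2*d) → ℕ) (z : Ed (2*d)),
      ‖mderiv α a z‖ ≤ Ch * h ^ mlen α * (mfact α : ℝ) ^ s) :
    ∀ A : ℝ, 0 < A → ∃ CA : ℝ, 0 < CA ∧ ∀ x ξ : Ed (2*d),
      ‖STFTgs φ a (x, ξ)‖ ≤ CA * Real.exp (-(A * ‖ξ‖ ^ (1/s))) := by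
  intro A hA
  have hs0 : 0 < s := by linarith
  rcases Nat.eq_zero_or_pos d with rfl | hd
  · have : Subsingleton (Ed (2 * 0)) := inferInstanceAs (Subsingleton (EuclideanSpace ℝ (Fin 0)))
    refine ⟨‖STFTgs φ a (0, 0)‖ + 1, by positivity, fun x ξ => ?_⟩
    rw [Subsingleton.elim x 0, Subsingleton.elim ξ 0, norm_zero, Real.zero_rpow (by positivity)]
    simp
  · have : NeZero (2 * d) := ⟨by positivity⟩
    have hd' : (0 : ℝ) < (2 * d : ℕ) := by exact_mod_cast Nat.mul_pos two_pos hd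
    obtain ⟨q, hq, hAq⟩ : ∃ q : ℝ, 0 < q ∧ A / s * q ^ (1 / s) ≤ 1 / 2 := by
      refine ⟨(s / (2 * A)) ^ s, by positivity, le_of_eq ?_⟩
      rw [← Real.rpow_mul (by positivity), mul_one_div_cancel hs0.ne', Real.rpow_one]
      field_simp
    have hh : 0 < q / (2 * (2 * d : ℕ)) := by positivity
    obtain ⟨Ca, hCa, hab⟩ := hest _ hh
    obtain ⟨C, hC, hb⟩ := exists_norm_pow_mul_STFTgs_le hs0.le hh hCa.le ha hφ.1 hab (hφ.2 _ hh)
    rw [show ((2 * d : ℕ) : ℝ) * (2 * (q / (2 * (2 * d : ℕ)))) = q by field_simp] at hb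
    refine ⟨2 ^ s * C + 1, by positivity, fun x ξ => ?_⟩
    refine (le_exp_neg_of_forall_pow_mul_le hs0 hA hq.le hC (norm_nonneg ξ) (norm_nonneg _) hAq
      (hb x ξ)).trans ?_
    gcongr
    linarith

end
end

section
/- Let s > 1/2 and let K ∈ 𝒮'(ℝ^{2d}) be a tempered distribution, with points of ℝ^{4d} = T*ℝ^{2d} written as (x,y,ξ,η), x,y,ξ,η ∈ ℝ^d. Suppose WF₁^s(K) = ∅ and WF₂^s(K) = ∅, where WF₁^s(K) := { (x,ξ) : (x,0,ξ,0) ∈ WF^s(K) } and WF₂^s(K) := { (y,η) : (0,y,0,−η) ∈ WF^s(K) }. Then there exists C > 1 such that WF^s(K) ⊆ { (x,y,ξ,η) ∈ ℝ^{4d} : C^{−1} |(x,ξ)| < |(y,η)| < C |(x,ξ)| }. -/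
open MeasureTheory Filter
open scoped BigOperators ENNReal RealInnerProductSpace

noncomputable section

/-- The points, possibly including the origin, without an open conic neighbourhood on which `W`
decays superexponentially of order `1/s`. -/
def WFs2Core {m n : ℕ} (s : ℝ) (W : (Ed m × Ed n) × (Ed m × Ed n) → ℂ) :
    Set ((Ed m × Ed n) × (Ed m × Ed n)) :=
  {z₀ | ¬ ∃ Γ : Set ((Ed m × Ed n) × (Ed m × Ed n)), IsOpen Γ ∧ IsConic Γ ∧
    (0 : (Ed m × Ed n) × (Ed m × Ed n)) ∉ Γ ∧ z₀ ∈ Γ ∧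
    ∀ A : ℝ, 0 < A → ∃ C : ℝ, ∀ z ∈ Γ, Real.exp (A * pnorm2 z ^ (1/s)) * ‖W z‖ ≤ C}

theorem mem_WFs2_iff {m n : ℕ} {s : ℝ} {W : (Ed m × Ed n) × (Ed m × Ed n) → ℂ}
    {z : (Ed m × Ed n) × (Ed m × Ed n)} : z ∈ WFs2 s W ↔ z ≠ 0 ∧ z ∈ WFs2Core s W :=
  Iff.rfl

theorem isClosed_WFs2Core {m n : ℕ} (s : ℝ) (W : (Ed m × Ed n) × (Ed m × Ed n) → ℂ) :
    IsClosed (WFs2Core s W) := by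
  refine ⟨isOpen_iff_mem_nhds.2 fun z hz => ?_⟩
  obtain ⟨Γ, ho, hc, h0, hzΓ, hb⟩ := not_not.1 hz
  exact Filter.mem_of_superset (ho.mem_nhds hzΓ)
    fun w hw => not_not.2 ⟨Γ, ho, hc, h0, hw, hb⟩

theorem isConic_WFs2 {m n : ℕ} (s : ℝ) (W : (Ed m × Ed n) × (Ed m × Ed n) → ℂ) :
    IsConic (WFs2 s W) := by
  rintro t ht z ⟨hz, h⟩
  refine ⟨smul_ne_zero ht.ne' hz, ?_⟩
  rintro ⟨Γ, ho, hc, h0, hzΓ, hb⟩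
  refine h ⟨Γ, ho, hc, h0, ?_, hb⟩
  simpa [smul_smul, inv_mul_cancel₀ ht.ne'] using hc t⁻¹ (inv_pos.2 ht) _ hzΓ

theorem isCompact_sphere_inter_WFs2 {m n : ℕ} (s : ℝ)
    (W : (Ed m × Ed n) × (Ed m × Ed n) → ℂ) :
    IsCompact (Metric.sphere 0 1 ∩ WFs2 s W) := by
  have h : Metric.sphere 0 1 ∩ WFs2 s W = Metric.sphere 0 1 ∩ WFs2Core s W := by
    ext z
    refine and_congr_right fun hz => ?_
    rw [mem_WFs2_iff]
    exact and_iff_right (ne_zero_of_mem_unit_sphere ⟨z, hz⟩)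
  rw [h]
  exact (isCompact_sphere _ _).inter_right (isClosed_WFs2Core s W)

theorem sqrt_sq_add_sq_pos {E F : Type*} [NormedAddCommGroup E] [NormedAddCommGroup F]
    {x : E} {ξ : F} (h : ¬ (x = 0 ∧ ξ = 0)) : 0 < Real.sqrt (‖x‖ ^ 2 + ‖ξ‖ ^ 2) := by
  refine Real.sqrt_pos.2 ((by positivity : 0 ≤ ‖x‖ ^ 2 + ‖ξ‖ ^ 2).lt_of_ne' fun h0 => h ?_)
  rw [add_eq_zero_iff_of_nonneg (by positivity) (by positivity)] at h0
  simpa using h0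

theorem sqrt_sq_add_sq_smul {E F : Type*} [NormedAddCommGroup E] [NormedAddCommGroup F]
    [NormedSpace ℝ E] [NormedSpace ℝ F] {t : ℝ} (ht : 0 ≤ t) (x : E) (ξ : F) :
    Real.sqrt (‖t • x‖ ^ 2 + ‖t • ξ‖ ^ 2) = t * Real.sqrt (‖x‖ ^ 2 + ‖ξ‖ ^ 2) := by
  rw [norm_smul, norm_smul, Real.norm_of_nonneg ht, mul_pow, mul_pow, ← mul_add,
    Real.sqrt_mul (sq_nonneg t), Real.sqrt_sq ht]

/-- Two positively homogeneous functions that are continuous and positive on the compact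
spherical section of a cone are comparable on the cone. -/
theorem exists_comparable_of_isConic {V : Type*} [NormedAddCommGroup V] [NormedSpace ℝ V]
    {S : Set V} (hS : IsConic S) (h0 : (0 : V) ∉ S) (hc : IsCompact (Metric.sphere 0 1 ∩ S))
    {f g : V → ℝ} (hf : Continuous f) (hg : Continuous g)
    (hfs : ∀ t : ℝ, 0 < t → ∀ z, f (t • z) = t * f z)
    (hgs : ∀ t : ℝ, 0 < t → ∀ z, g (t • z) = t * g z)
    (hf0 : ∀ z ∈ S, 0 < f z) (hg0 : ∀ z ∈ S, 0 < g z) :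
    ∃ C : ℝ, 1 < C ∧ ∀ z ∈ S, C⁻¹ * f z < g z ∧ g z < C * f z := by
  obtain ⟨M, hM⟩ := (hc.bddAbove_image (f := fun z => f z / g z)
    (hf.continuousOn.div hg.continuousOn fun z hz => (hg0 z hz.2).ne'))
  obtain ⟨N, hN⟩ := (hc.bddAbove_image (f := fun z => g z / f z)
    (hg.continuousOn.div hf.continuousOn fun z hz => (hf0 z hz.2).ne'))
  refine ⟨|M| + |N| + 2, by linarith [abs_nonneg M, abs_nonneg N], fun z hz => ?_⟩
  have hz0 : 0 < ‖z‖⁻¹ := inv_pos.2 (norm_pos_iff.2 fun h => h0 (h ▸ hz))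
  have hu : ‖z‖⁻¹ • z ∈ Metric.sphere (0 : V) 1 ∩ S :=
    ⟨by simpa [norm_smul] using inv_mul_cancel₀ (inv_pos.1 hz0).ne', hS _ hz0 z hz⟩
  have h1 : f z / g z ≤ M := by
    simpa only [hfs _ hz0, hgs _ hz0, mul_div_mul_left _ _ hz0.ne'] using
      hM (Set.mem_image_of_mem _ hu)
  have h2 : g z / f z ≤ N := by
    simpa only [hfs _ hz0, hgs _ hz0, mul_div_mul_left _ _ hz0.ne'] using
      hN (Set.mem_image_of_mem _ hu)
  have hC : 0 < |M| + |N| + 2 := by positivity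
  constructor
  · rw [inv_mul_lt_iff₀ hC, ← div_lt_iff₀ (hg0 z hz)]
    linarith [le_abs_self M, abs_nonneg N]
  · rw [← div_lt_iff₀ (hf0 z hz)]
    linarith [le_abs_self N, abs_nonneg M]

theorem statement16 (d : ℕ) (s : ℝ) (hs : 1/2 < s)
    (K : TD2 d d)
    (φ ψ : Ed d → ℂ) (hφ : φ ∈ SigmaGS s d) (hφ0 : φ ≠ 0)
    (hψ : ψ ∈ SigmaGS s d) (hψ0 : ψ ≠ 0)
    (W : (Ed d × Ed d) × (Ed d × Ed d) → ℂ)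
    (hW : IsSTFT2 K (fun p => φ p.1 * ψ p.2) W)
    (hWF1 : ∀ x ξ : Ed d, ((x, (0 : Ed d)), (ξ, (0 : Ed d))) ∉ WFs2 s W)
    (hWF2 : ∀ y η : Ed d, (((0 : Ed d), y), ((0 : Ed d), -η)) ∉ WFs2 s W) :
    ∃ C : ℝ, 1 < C ∧ ∀ z ∈ WFs2 s W,
      C⁻¹ * Real.sqrt (‖z.1.1‖ ^ 2 + ‖z.2.1‖ ^ 2) < Real.sqrt (‖z.1.2‖ ^ 2 + ‖z.2.2‖ ^ 2) ∧
      Real.sqrt (‖z.1.2‖ ^ 2 + ‖z.2.2‖ ^ 2) < C * Real.sqrt (‖z.1.1‖ ^ 2 + ‖z.2.1‖ ^ 2) := by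
  refine exists_comparable_of_isConic (isConic_WFs2 s W) (fun h => h.1 rfl)
    (isCompact_sphere_inter_WFs2 s W)
    (f := fun z => Real.sqrt (‖z.1.1‖ ^ 2 + ‖z.2.1‖ ^ 2))
    (g := fun z => Real.sqrt (‖z.1.2‖ ^ 2 + ‖z.2.2‖ ^ 2)) (by fun_prop) (by fun_prop)
    (fun t ht z => sqrt_sq_add_sq_smul ht.le _ _) (fun t ht z => sqrt_sq_add_sq_smul ht.le _ _)
    ?_ ?_
  · rintro ⟨⟨x, y⟩, ξ, η⟩ hz
    refine sqrt_sq_add_sq_pos ?_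
    rintro ⟨rfl, rfl⟩
    exact hWF2 y (-η) (by rwa [neg_neg])
  · rintro ⟨⟨x, y⟩, ξ, η⟩ hz
    refine sqrt_sq_add_sq_pos ?_
    rintro ⟨rfl, rfl⟩
    exact hWF1 x ξ hz

end
end
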